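/- arXiv:1012.4615 — 2 statements merged into one kernel-verified Lean document; each statement's English description precedes it below -/
import Mathlib

section
/- For monic $f,g$ of degrees $d\le e$ with roots $A=(\alpha_1,\ldots,\alpha_d)$ and $B=(\beta_1,\ldots,\beta_e)$ (all simple), Sylvester's identity holds: for $0\le p\le d$, $0\le q\le e$ with $t=p+q$ satisfying $t<d\le e$ or $t=d<e$, $\mathrm{Sres}_t(f,g)=(-1)^{p(d-t)}\binom{t}{p}^{-1}\mathrm{Sylv}^{p,q}(A,B;x)$. -/
open Finset Polynomial

/-- The `t`-th subresultant of `f` and `g` (of formal degrees `d` and `e`), defined as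
the determinant of the `(d+e-2t) × (d+e-2t)` Sylvester-type matrix whose first `e-t`
rows contain the coefficients of `f` (shifted), last column `x^{e-t-1-r} f`, and whose
last `d-t` rows contain the coefficients of `g` (shifted), last column `x^{d-t-1-r'} g`. -/
noncomputable def Sres {K : Type*} [CommRing K] (f g : Polynomial K) (d e t : ℕ) :
    Polynomial K :=
  Matrix.det (Matrix.of fun r c : Fin (d + e - 2 * t) =>
    if (r : ℕ) < e - t then
      if (c : ℕ) = d + e - 2 * t - 1 then X ^ (e - t - 1 - (r : ℕ)) * f
      else if (c : ℕ) ≤ d + (r : ℕ) then Polynomial.C (f.coeff (d + (r : ℕ) - (c : ℕ)))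
      else 0
    else
      if (c : ℕ) = d + e - 2 * t - 1 then X ^ (d - t - 1 - ((r : ℕ) - (e - t))) * g
      else if (c : ℕ) ≤ e + ((r : ℕ) - (e - t)) then
        Polynomial.C (g.coeff (e + ((r : ℕ) - (e - t)) - (c : ℕ)))
      else 0)


section
variable {K : Type*} [Field K]

theorem vand_append {q m : ℕ} (a : Fin q ⊕ Fin m → K) :
    (Matrix.of fun s c : Fin q ⊕ Fin m => a s ^ (finSumFinEquiv c : ℕ)).det =
      (Matrix.vandermonde fun j => a (Sum.inl j)).det *
      (Matrix.vandermonde fun j => a (Sum.inr j)).det *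
      ∏ k, ∏ j, (a (Sum.inr k) - a (Sum.inl j)) := by
  have h : (Matrix.of fun s c : Fin q ⊕ Fin m => a s ^ (finSumFinEquiv c : ℕ)) =
      (Matrix.vandermonde fun s => a (finSumFinEquiv.symm s)).submatrix
        finSumFinEquiv finSumFinEquiv := by
    ext s c
    simp [Matrix.vandermonde_apply]
  rw [h, Matrix.det_submatrix_equiv_self]
  have h2 : ∀ (n : ℕ) (v : Fin n → K), (Matrix.vandermonde v).det =
      ∏ i, ∏ j, if i < j then (v j - v i) else 1 := by
    intro n v
    rw [Matrix.det_vandermonde]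
    refine prod_congr rfl fun i _ => ?_
    rw [← prod_filter]
    congr 1
    ext j; simp
  rw [h2, h2, h2, Fin.prod_univ_add]
  simp only [Fin.prod_univ_add, finSumFinEquiv_symm_apply_castAdd,
    finSumFinEquiv_symm_apply_natAdd]
  have h3 : ∀ (i : Fin q) (j : Fin m), Fin.castAdd m i < Fin.natAdd q j := by
    intro i j; simp [Fin.lt_def]; omega
  have h4 : ∀ (i : Fin q) (j : Fin m), ¬ Fin.natAdd q j < Fin.castAdd m i := by
    intro i j; simp [Fin.lt_def]; omega
  simp only [h3, h4, if_true, if_false, prod_const_one, one_mul, prod_mul_distrib]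
  rw [prod_comm (s := univ) (t := univ) (f := fun (i : Fin q) (j : Fin m) => a (Sum.inr j) - a (Sum.inl i))]
  have h5 : ∀ (i j : Fin q), Fin.castAdd m i < Fin.castAdd m j ↔ i < j := by
    intro i j; exact Iff.rfl
  have h6 : ∀ (i j : Fin m), Fin.natAdd q i < Fin.natAdd q j ↔ i < j := by
    intro i j; simp only [Fin.lt_def, Fin.val_natAdd]; omega
  simp only [h5, h6]
  ring

theorem exists_enum {q m : ℕ} (S : Finset (Fin q ⊕ Fin m)) (hS : S.card = q) :
    ∃ σ : Equiv.Perm (Fin q ⊕ Fin m), (∀ j, σ (Sum.inl j) ∈ S) ∧ ∀ k, σ (Sum.inr k) ∉ S := by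
  have h2 : Sᶜ.card = m := by rw [card_compl, hS]; simp
  let e1 : Fin q ≃ {x // x ∈ S} := (S.equivFinOfCardEq hS).symm
  let e2 : Fin m ≃ {x // ¬ x ∈ S} :=
    (Sᶜ.equivFinOfCardEq h2).symm.trans (Equiv.subtypeEquivRight (by simp))
  refine ⟨(Equiv.sumCongr e1 e2).trans (Equiv.sumCompl _), ?_, ?_⟩
  · intro j; simp
  · intro k; simpa using (e2 k).2

theorem det_piece {q m : ℕ} (a : Fin q ⊕ Fin m → K) (ha : Function.Injective a)
    (S : Finset (Fin q ⊕ Fin m)) :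
    (Matrix.of fun s c : Fin q ⊕ Fin m =>
      if s ∈ S then (Sum.elim (fun j : Fin q => a s ^ (j : ℕ)) (fun _ : Fin m => 0) c : K)
      else (Sum.elim (fun _ : Fin q => 0) (fun k : Fin m => a s ^ (k : ℕ)) c : K)).det =
    if S.card = q then
      (Matrix.of fun s c : Fin q ⊕ Fin m => a s ^ (finSumFinEquiv c : ℕ)).det /
        ∏ s ∈ Sᶜ, ∏ s' ∈ S, (a s - a s')
    else 0 := by
  split_ifs with hS
  · obtain ⟨σ, h1, h2⟩ := exists_enum S hS
    set M := (Matrix.of fun s c : Fin q ⊕ Fin m =>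
      if s ∈ S then (Sum.elim (fun j : Fin q => a s ^ (j : ℕ)) (fun _ : Fin m => 0) c : K)
      else (Sum.elim (fun _ : Fin q => 0) (fun k : Fin m => a s ^ (k : ℕ)) c : K)) with hM
    set V := (Matrix.of fun s c : Fin q ⊕ Fin m => a s ^ (finSumFinEquiv c : ℕ)) with hV
    have e1 := Matrix.det_permute σ M
    have e2 := Matrix.det_permute σ V
    have e3 : M.submatrix σ id = Matrix.fromBlocks
        (Matrix.vandermonde fun j => a (σ (Sum.inl j))) 0 0
        (Matrix.vandermonde fun j => a (σ (Sum.inr j))) := by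
      ext s c
      rcases s with s | s <;> rcases c with c | c <;> simp [hM, h1, h2, Matrix.vandermonde_apply]
    have e4 := vand_append (fun s => a (σ s))
    have e5 : V.submatrix σ id =
        (Matrix.of fun s c : Fin q ⊕ Fin m => a (σ s) ^ (finSumFinEquiv c : ℕ)) := rfl
    rw [e5, e4] at e2
    rw [e3, Matrix.det_fromBlocks_zero₁₂] at e1
    rw [e1] at e2
    have i1 : S = univ.image (fun j => σ (Sum.inl j)) := by
      symm
      apply eq_of_subset_of_card_le
      · intro x; simp only [mem_image, mem_univ, true_and]; rintro ⟨j, rfl⟩; exact h1 j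
      · rw [card_image_of_injective _ (fun x y h => Sum.inl_injective (σ.injective h))]; simp [hS]
    have i2 : Sᶜ = univ.image (fun j => σ (Sum.inr j)) := by
      symm
      apply eq_of_subset_of_card_le
      · intro x; simp only [mem_image, mem_univ, true_and]; rintro ⟨j, rfl⟩; simpa using h2 j
      · rw [card_image_of_injective _ (fun x y h => Sum.inr_injective (σ.injective h))]
        simp [card_compl, hS]
    have i3 : ∏ s ∈ Sᶜ, ∏ s' ∈ S, (a s - a s') =
        ∏ k, ∏ j, (a (σ (Sum.inr k)) - a (σ (Sum.inl j))) := by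
      rw [i2]
      rw [prod_image (fun x _ y _ h => Sum.inr_injective (σ.injective h))]
      refine prod_congr rfl fun k _ => ?_
      conv_lhs => rw [i1]
      rw [prod_image (fun x _ y _ h => Sum.inl_injective (σ.injective h))]
    have i4 : ∏ s ∈ Sᶜ, ∏ s' ∈ S, (a s - a s') ≠ 0 := by
      refine prod_ne_zero_iff.2 fun s hs => prod_ne_zero_iff.2 fun s' hs' => sub_ne_zero.2 ?_
      intro h
      rw [ha h] at hs
      exact (mem_compl.1 hs) hs'
    rw [eq_div_iff i4, i3]
    have i5 : ((Equiv.Perm.sign σ : ℤ) : K) ≠ 0 := by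
      rcases Int.units_eq_one_or (Equiv.Perm.sign σ) with h | h <;> simp [h]
    apply mul_left_cancel₀ i5
    rw [← e2]; ring
  · rw [Matrix.det_apply']
    refine sum_eq_zero fun σ _ => ?_
    rw [mul_eq_zero]; right
    by_contra hne
    replace hne := prod_ne_zero_iff.1 hne
    apply hS
    have h1 : ∀ j, σ (Sum.inl j) ∈ S := by
      intro j
      by_contra h
      exact hne (Sum.inl j) (mem_univ _) (by simp [h])
    have h2 : ∀ j, σ (Sum.inr j) ∉ S := by
      intro j h
      exact hne (Sum.inr j) (mem_univ _) (by simp [h])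
    have c1 : q ≤ S.card := by
      have := card_le_card (s := univ.image (fun j => σ (Sum.inl j))) (t := S)
        (by intro x; simp only [mem_image, mem_univ, true_and]; rintro ⟨j, rfl⟩; exact h1 j)
      rw [card_image_of_injective _ (fun x y h => Sum.inl_injective (σ.injective h))] at this
      simpa using this
    have c2 : m ≤ Sᶜ.card := by
      have := card_le_card (s := univ.image (fun j => σ (Sum.inr j))) (t := Sᶜ)
        (by intro x; simp only [mem_image, mem_univ, true_and]; rintro ⟨j, rfl⟩; simpa using h2 j)
      rw [card_image_of_injective _ (fun x y h => Sum.inr_injective (σ.injective h))] at this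
      simpa using this
    have c3 := card_add_card_compl S
    rw [Fintype.card_sum, Fintype.card_fin, Fintype.card_fin] at c3
    omega

theorem laplace {q m : ℕ} (a : Fin q ⊕ Fin m → K) (ha : Function.Injective a) (u v : K → K) :
    (Matrix.of fun s c : Fin q ⊕ Fin m =>
      (Sum.elim (fun j : Fin q => u (a s) * a s ^ (j : ℕ)) (fun k : Fin m => v (a s) * a s ^ (k : ℕ)) c : K)).det =
    (Matrix.of fun s c : Fin q ⊕ Fin m => a s ^ (finSumFinEquiv c : ℕ)).det *
      ∑ S ∈ powersetCard q univ, (∏ s ∈ S, u (a s)) * (∏ s ∈ Sᶜ, v (a s)) /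
        ∏ s ∈ Sᶜ, ∏ s' ∈ S, (a s - a s') := by
  have h := (Matrix.detRowAlternating (R := K) (n := Fin q ⊕ Fin m)).toMultilinearMap.map_add_univ
    (fun s c => (Sum.elim (fun j : Fin q => u (a s) * a s ^ (j : ℕ)) (fun _ : Fin m => 0) c : K))
    (fun s c => (Sum.elim (fun _ : Fin q => 0) (fun k : Fin m => v (a s) * a s ^ (k : ℕ)) c : K))
  have h0 : (Matrix.of fun s c : Fin q ⊕ Fin m =>
      (Sum.elim (fun j : Fin q => u (a s) * a s ^ (j : ℕ)) (fun k : Fin m => v (a s) * a s ^ (k : ℕ)) c : K)) =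
      (fun s c => (Sum.elim (fun j : Fin q => u (a s) * a s ^ (j : ℕ)) (fun _ : Fin m => 0) c : K)) +
    (fun s c => (Sum.elim (fun _ : Fin q => 0) (fun k : Fin m => v (a s) * a s ^ (k : ℕ)) c : K)) := by
    ext s c
    rcases c with c | c <;> simp
  rw [h0]
  refine Eq.trans h ?_
  have h1 : ∀ S : Finset (Fin q ⊕ Fin m),
      Matrix.detRowAlternating.toMultilinearMap (S.piecewise
    (fun s c => (Sum.elim (fun j : Fin q => u (a s) * a s ^ (j : ℕ)) (fun _ : Fin m => 0) c : K))
    (fun s c => (Sum.elim (fun _ : Fin q => 0) (fun k : Fin m => v (a s) * a s ^ (k : ℕ)) c : K))) =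
      (∏ s ∈ S, u (a s)) * (∏ s ∈ Sᶜ, v (a s)) * (Matrix.of fun s c : Fin q ⊕ Fin m =>
      if s ∈ S then (Sum.elim (fun j : Fin q => a s ^ (j : ℕ)) (fun _ : Fin m => 0) c : K)
      else (Sum.elim (fun _ : Fin q => 0) (fun k : Fin m => a s ^ (k : ℕ)) c : K)).det := by
    intro S
    have h2 := Matrix.det_mul_column (fun s => if s ∈ S then u (a s) else v (a s))
      (Matrix.of fun s c : Fin q ⊕ Fin m =>
      if s ∈ S then (Sum.elim (fun j : Fin q => a s ^ (j : ℕ)) (fun _ : Fin m => 0) c : K)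
      else (Sum.elim (fun _ : Fin q => 0) (fun k : Fin m => a s ^ (k : ℕ)) c : K))
    have h3 : (∏ s, if s ∈ S then u (a s) else v (a s)) =
      (∏ s ∈ S, u (a s)) * (∏ s ∈ Sᶜ, v (a s)) := by
      rw [prod_ite]
      congr 1
      · congr 1; ext; simp
      · congr 1; ext; simp
    rw [h3] at h2
    rw [← h2]
    change Matrix.det _ = Matrix.det _
    congr 1
    ext s c
    by_cases hs : s ∈ S <;> rcases c with c | c <;> simp [hs]
  simp only [h1, det_piece a ha]
  rw [mul_sum]
  have : (powersetCard q univ : Finset (Finset (Fin q ⊕ Fin m))) =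
      univ.filter (fun S => S.card = q) := by
    ext S; simp [mem_powersetCard]
  rw [this, sum_filter]
  refine sum_congr rfl fun S _ => ?_
  split_ifs
  · ring
  · simp

/-- rows of the block matrix -/
noncomputable def rowPoly (q m n : ℕ) (Y g f : K[X]) : (Fin q ⊕ Fin m) ⊕ Fin n → K[X] :=
  Sum.elim (Sum.elim (fun j => Y * X ^ (j : ℕ)) (fun k => g * X ^ (k : ℕ)))
    (fun l => f * X ^ (l : ℕ))

/-- position of columns -/
def colPos (q m n : ℕ) : (Fin q ⊕ Fin m) ⊕ Fin n → ℕ :=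
  Sum.elim (fun c => (finSumFinEquiv c : ℕ)) (fun l => q + m + (l : ℕ))

/-- the block matrix -/
noncomputable def blockMat (q m n : ℕ) (Y g f : K[X]) :
    Matrix ((Fin q ⊕ Fin m) ⊕ Fin n) ((Fin q ⊕ Fin m) ⊕ Fin n) K :=
  Matrix.of fun i j => (rowPoly q m n Y g f i).coeff (colPos q m n j)

/-- the single sum -/
noncomputable def singleSum (q : ℕ) (A : Finset K) (u v : K → K) [DecidableEq K] : K :=
  ∑ S ∈ powersetCard q A, (∏ s ∈ S, u s) * (∏ s ∈ A \ S, v s) /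
        ∏ s ∈ A \ S, ∏ s' ∈ S, (s - s')

theorem sum_colPos (q m n : ℕ) (h : ℕ → K) :
    ∑ j, h (colPos q m n j) = ∑ i ∈ range (q + m + n), h i := by
  rw [Finset.sum_range, Fin.sum_univ_add, Fin.sum_univ_add]
  simp [colPos, Fintype.sum_sum_type]

theorem laplace_finset [DecidableEq K] {q m : ℕ} (a : Fin q ⊕ Fin m → K)
    (ha : Function.Injective a) (u v : K → K) :
    (∑ S ∈ powersetCard q univ, (∏ s ∈ S, u (a s)) * (∏ s ∈ Sᶜ, v (a s)) /
        ∏ s ∈ Sᶜ, ∏ s' ∈ S, (a s - a s')) = singleSum q (univ.map ⟨a, ha⟩) u v := by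
  unfold singleSum
  rw [powersetCard_map, sum_map]
  refine sum_congr rfl fun S _ => ?_
  have : univ.map ⟨a, ha⟩ \ S.map ⟨a, ha⟩ = Sᶜ.map ⟨a, ha⟩ := by
    rw [compl_eq_univ_sdiff, Finset.map_sdiff]
  simp only [RelEmbedding.coe_toEmbedding, mapEmbedding_apply, this, prod_map,
    Function.Embedding.coeFn_mk]

theorem det_blockMat [DecidableEq K] {q m n : ℕ} (A : Finset K) (hA : A.card = q + m)
    (Y g : K[X]) (hY : Y.natDegree ≤ m + n) (hg : g.natDegree ≤ q + n) :
    (blockMat q m n Y g (∏ a ∈ A, (X - C a))).det =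
      singleSum q A (fun s => Y.eval s) (fun s => g.eval s) := by
  set f : K[X] := ∏ a ∈ A, (X - C a) with hf
  have hfm : f.Monic := monic_prod_of_monic _ _ fun a _ => monic_X_sub_C a
  have hfd : f.natDegree = q + m := by
    rw [hf, natDegree_prod_of_monic _ _ fun a _ => monic_X_sub_C a]; simp [hA]
  obtain ⟨e⟩ : Nonempty (Fin q ⊕ Fin m ≃ {x // x ∈ A}) :=
    ⟨finSumFinEquiv.trans (A.equivFinOfCardEq hA).symm⟩
  let a : Fin q ⊕ Fin m → K := fun s => (e s : K)
  have ha : Function.Injective a := fun x y h => e.injective (Subtype.ext h)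
  have hmap : univ.map ⟨a, ha⟩ = A := by
    ext x
    simp only [mem_map, mem_univ, true_and, Function.Embedding.coeFn_mk]
    constructor
    · rintro ⟨s, rfl⟩; exact (e s).2
    · intro hx; exact ⟨e.symm ⟨x, hx⟩, by simp [a]⟩
  have hroot : ∀ s, f.eval (a s) = 0 := by
    intro s
    rw [hf, eval_prod]
    exact prod_eq_zero (e s).2 (by simp [a])
  have hL := laplace a ha (fun s => Y.eval s) (fun s => g.eval s)
  rw [laplace_finset a ha (fun s => Y.eval s) (fun s => g.eval s), hmap] at hL
  set V := (Matrix.of fun s c : Fin q ⊕ Fin m => a s ^ (finSumFinEquiv c : ℕ)) with hV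
  have hVne : V.det ≠ 0 := by
    have h : V = (Matrix.vandermonde fun s => a (finSumFinEquiv.symm s)).submatrix
        finSumFinEquiv finSumFinEquiv := by
      ext s c
      simp [hV, Matrix.vandermonde_apply]
    rw [h, Matrix.det_submatrix_equiv_self, Matrix.det_vandermonde_ne_zero_iff]
    exact ha.comp (finSumFinEquiv.symm.injective)
  let L : Matrix (Fin n) (Fin q ⊕ Fin m) K := Matrix.of fun l s => a s ^ (q + m + (l : ℕ))
  let W := Matrix.fromBlocks V.transpose 0 L (1 : Matrix (Fin n) (Fin n) K)
  have hW : W.det = V.det := by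
    simp [W]
  have hWl : ∀ j s, W j (Sum.inl s) = a s ^ (colPos q m n j) := by
    intro j s
    rcases j with j | j
    · simp [W, hV, colPos]
    · simp [W, L, colPos]
  have hdeg : ∀ i, (rowPoly q m n Y g f i).natDegree < q + m + n := by
    intro i
    rcases i with (i | i) | i <;> simp only [rowPoly, Sum.elim_inl, Sum.elim_inr] <;>
      refine lt_of_le_of_lt natDegree_mul_le ?_ <;> rw [natDegree_X_pow] <;> have := i.2 <;> omega
  let E : Matrix (Fin q ⊕ Fin m) (Fin q ⊕ Fin m) K := Matrix.of fun s c : Fin q ⊕ Fin m =>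
      (Sum.elim (fun j : Fin q => Y.eval (a s) * a s ^ (j : ℕ))
        (fun k : Fin m => g.eval (a s) * a s ^ (k : ℕ)) c : K)
  let U : Matrix (Fin n) (Fin n) K := Matrix.of fun k l => (f * X ^ (k : ℕ)).coeff (q + m + l)
  have hU : U.det = 1 := by
    rw [Matrix.det_of_isLowerTriangular]
    · refine prod_eq_one fun k _ => ?_
      have : (f * X ^ (k : ℕ)).coeff (f.natDegree + k) = 1 := by
        rw [coeff_mul_X_pow]; exact hfm
      rw [hfd] at this
      exact this
    · intro k l hkl
      have hkl' : (k : ℕ) < l := hkl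
      change (f * X ^ (k : ℕ)).coeff (q + m + l) = 0
      apply coeff_eq_zero_of_natDegree_lt
      refine lt_of_le_of_lt natDegree_mul_le ?_
      rw [natDegree_X_pow, hfd]; omega
  have hCW : ∃ Z, blockMat q m n Y g f * W = Matrix.fromBlocks E.transpose Z 0 U := by
    refine ⟨Matrix.of fun i l => (rowPoly q m n Y g f (Sum.inl i)).coeff (q + m + l), ?_⟩
    have h1 : ∀ i s, (blockMat q m n Y g f * W) i (Sum.inl s) =
        (rowPoly q m n Y g f i).eval (a s) := by
      intro i s
      rw [Matrix.mul_apply, eval_eq_sum_range' (hdeg i), ← sum_colPos q m n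
        (fun c => (rowPoly q m n Y g f i).coeff c * a s ^ c)]
      refine sum_congr rfl fun j _ => ?_
      rw [hWl]; rfl
    have h2 : ∀ i l, (blockMat q m n Y g f * W) i (Sum.inr l) =
        (rowPoly q m n Y g f i).coeff (q + m + l) := by
      intro i l
      rw [Matrix.mul_apply, Fintype.sum_sum_type]
      simp [W, Matrix.one_apply, blockMat, colPos]
    ext i j
    rcases j with s | l
    · rw [h1]
      rcases i with (i | i) | i <;> simp [rowPoly, E, hroot]
    · rw [h2]
      rcases i with i | i <;> simp [U, rowPoly]
  obtain ⟨Z, hZ⟩ := hCW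
  have hdet := congrArg Matrix.det hZ
  rw [Matrix.det_mul, Matrix.det_fromBlocks_zero₂₁, hU, hW, mul_one, Matrix.det_transpose] at hdet
  apply mul_right_cancel₀ hVne
  rw [hdet, mul_comm]
  exact hL

theorem sign_flip (m n : ℕ) :
    Equiv.Perm.sign (((Equiv.sumComm (Fin m) (Fin n)).trans finSumFinEquiv).trans
      ((finCongr (add_comm n m)).trans finSumFinEquiv.symm)) = (-1) ^ (m * n) := by
  have h1 : Equiv.Perm.sign (finSumFinEquiv.symm.trans ((((Equiv.sumComm (Fin m) (Fin n)).trans finSumFinEquiv).trans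
      ((finCongr (add_comm n m)).trans finSumFinEquiv.symm)).trans finSumFinEquiv)) = (-1) ^ (m * n) := by
    rw [Equiv.Perm.sign_eq_prod_prod_Ioi]
    have : ∀ i : Fin (m+n), ∀ F : Fin (m+n) → ℤˣ, ∏ j ∈ Ioi i, F j = ∏ j, if i < j then F j else 1 := by
      intro i F
      rw [← prod_filter]
      congr 1; ext; simp
    simp only [this]
    rw [Fin.prod_univ_add]
    have e1 : ∀ i : Fin m, (finSumFinEquiv.symm.trans ((((Equiv.sumComm (Fin m) (Fin n)).trans finSumFinEquiv).trans
      ((finCongr (add_comm n m)).trans finSumFinEquiv.symm)).trans finSumFinEquiv)) (Fin.castAdd n i) =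
        finCongr (add_comm n m) (Fin.natAdd n i) := by intro i; simp
    have e2 : ∀ i : Fin n, (finSumFinEquiv.symm.trans ((((Equiv.sumComm (Fin m) (Fin n)).trans finSumFinEquiv).trans
      ((finCongr (add_comm n m)).trans finSumFinEquiv.symm)).trans finSumFinEquiv)) (Fin.natAdd m i) =
        finCongr (add_comm n m) (Fin.castAdd m i) := by intro i; simp
    simp only [Fin.prod_univ_add, e1, e2]
    have a1 : ∀ i j : Fin m, (if Fin.castAdd n i < Fin.castAdd n j then
        (if finCongr (add_comm n m) (Fin.natAdd n i) < finCongr (add_comm n m) (Fin.natAdd n j) then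
          (1 : ℤˣ) else -1) else 1) = 1 := by
      intro i j
      simp only [Fin.lt_def, finCongr_apply, Fin.val_cast, Fin.val_natAdd, Fin.val_castAdd]
      split_ifs with h h' <;> first | rfl | (exfalso; omega)
    have a2 : ∀ i j : Fin n, (if Fin.natAdd m i < Fin.natAdd m j then
        (if finCongr (add_comm n m) (Fin.castAdd m i) < finCongr (add_comm n m) (Fin.castAdd m j) then
          (1 : ℤˣ) else -1) else 1) = 1 := by
      intro i j
      simp only [Fin.lt_def, finCongr_apply, Fin.val_cast, Fin.val_natAdd, Fin.val_castAdd]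
      split_ifs with h h' <;> first | rfl | (exfalso; omega)
    have a3 : ∀ (i : Fin m) (j : Fin n), (if Fin.castAdd n i < Fin.natAdd m j then
        (if finCongr (add_comm n m) (Fin.natAdd n i) < finCongr (add_comm n m) (Fin.castAdd m j) then
          (1 : ℤˣ) else -1) else 1) = -1 := by
      intro i j
      rw [if_pos, if_neg]
      · simp only [Fin.lt_def, finCongr_apply, Fin.val_cast, Fin.val_natAdd, Fin.val_castAdd]; omega
      · simp only [Fin.lt_def, Fin.val_natAdd, Fin.val_castAdd]; omega
    have a4 : ∀ (i : Fin n) (j : Fin m), (if Fin.natAdd m i < Fin.castAdd n j then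
        (if finCongr (add_comm n m) (Fin.castAdd m i) < finCongr (add_comm n m) (Fin.natAdd n j) then
          (1 : ℤˣ) else -1) else 1) = 1 := by
      intro i j
      rw [if_neg]
      simp only [Fin.lt_def, Fin.val_natAdd, Fin.val_castAdd]; omega
    simp only [a1, a2, a3, a4]
    simp [pow_mul, mul_comm m n]
  rw [← h1]
  exact (Equiv.Perm.sign_symm_trans_trans _ finSumFinEquiv).symm

theorem det_blockMat_swap {q m n : ℕ} (Y g f : K[X]) :
    (blockMat q n m Y f g).det = (-1) ^ (m * n) * (blockMat q m n Y g f).det := by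
  let π := (((Equiv.sumComm (Fin m) (Fin n)).trans finSumFinEquiv).trans
      ((finCongr (add_comm n m)).trans finSumFinEquiv.symm))
  let π' : Equiv.Perm ((Fin q ⊕ Fin m) ⊕ Fin n) :=
    (Equiv.sumAssoc _ _ _).trans
      ((Equiv.Perm.sumCongr (1 : Equiv.Perm (Fin q)) π).trans (Equiv.sumAssoc _ _ _).symm)
  let ρ : (Fin q ⊕ Fin m) ⊕ Fin n ≃ (Fin q ⊕ Fin n) ⊕ Fin m :=
    (Equiv.sumAssoc _ _ _).trans
      ((Equiv.sumCongr (Equiv.refl _) (Equiv.sumComm _ _)).trans (Equiv.sumAssoc _ _ _).symm)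
  have hs : Equiv.Perm.sign π' = (-1) ^ (m * n) := by
    have h1 := Equiv.Perm.sign_symm_trans_trans (Equiv.Perm.sumCongr (1 : Equiv.Perm (Fin q)) π)
      (Equiv.sumAssoc (Fin q) (Fin m) (Fin n)).symm
    rw [Equiv.Perm.sign_sumCongr, Equiv.Perm.sign_one, one_mul, sign_flip] at h1
    exact h1
  have h2 := Matrix.det_permute' π' (blockMat q m n Y g f)
  rw [hs] at h2
  rw [← Matrix.det_submatrix_equiv_self ρ (blockMat q n m Y f g)]
  have h3 : (blockMat q n m Y f g).submatrix ρ ρ = (blockMat q m n Y g f).submatrix id π' := by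
    ext i j
    have hr : rowPoly q n m Y f g (ρ i) = rowPoly q m n Y g f i := by
      rcases i with (i | i) | i <;> simp [ρ, rowPoly]
    have hpi : ∀ x : Fin m ⊕ Fin n, (finSumFinEquiv (π x) : ℕ) = (finSumFinEquiv (x.swap) : ℕ) := by
      intro x; simp [π]
    have hq : ∀ x : Fin m ⊕ Fin n, colPos q m n ((Equiv.sumAssoc _ _ _).symm (Sum.inr x)) =
        q + (finSumFinEquiv x : ℕ) := by
      intro x; rcases x with x | x <;> simp [colPos, add_assoc]
    have hc : colPos q n m (ρ j) = colPos q m n (π' j) := by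
      rcases j with (j | j) | j
      · simp [ρ, π', colPos]
      · have h4 : π' (Sum.inl (Sum.inr j)) = (Equiv.sumAssoc _ _ _).symm (Sum.inr (π (Sum.inl j))) := by
          simp [π']
        rw [h4, hq, hpi]
        simp [ρ, colPos, add_assoc]
      · have h4 : π' (Sum.inr j) = (Equiv.sumAssoc _ _ _).symm (Sum.inr (π (Sum.inr j))) := by
          simp [π']
        rw [h4, hq, hpi]
        simp [ρ, colPos]
    simp only [Matrix.submatrix_apply, blockMat, Matrix.of_apply, hr, hc, id]
  rw [h3, h2]
  simp

theorem exchange [DecidableEq K] {q m n : ℕ} (A B : Finset K) (hA : A.card = q + m)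
    (hB : B.card = q + n) (Y : K[X]) (hY : Y.natDegree ≤ m + n) :
    singleSum q B (fun s => Y.eval s) (fun s => (∏ a ∈ A, (X - C a)).eval s) =
      (-1) ^ (m * n) *
      singleSum q A (fun s => Y.eval s) (fun s => (∏ b ∈ B, (X - C b)).eval s) := by
  have hd : ∀ A : Finset K, (∏ a ∈ A, (X - C a)).natDegree = A.card := by
    intro A; rw [natDegree_prod_of_monic _ _ fun a _ => monic_X_sub_C a]; simp
  rw [← det_blockMat (n := m) B hB Y _ (by omega) (by rw [hd]; omega),
    ← det_blockMat (n := n) A hA Y _ (by omega) (by rw [hd]; omega), det_blockMat_swap]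

theorem sum_union_pairs [DecidableEq K] (A : Finset K) (p q : ℕ) (T : Finset K → K) :
    ∑ A' ∈ powersetCard p A, ∑ S ∈ powersetCard q (A \ A'), T (A' ∪ S) =
      ((p + q).choose p : K) * ∑ D ∈ powersetCard (p + q) A, T D := by
  have h : ∑ D ∈ powersetCard (p + q) A, ∑ A' ∈ powersetCard p D, T D =
      ((p + q).choose p : K) * ∑ D ∈ powersetCard (p + q) A, T D := by
    rw [mul_sum]
    refine sum_congr rfl fun D hD => ?_
    rw [sum_const, card_powersetCard, (mem_powersetCard.1 hD).2, nsmul_eq_mul]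
  rw [← h, sum_sigma', sum_sigma']
  refine sum_bij' (fun z _ => ⟨z.1 ∪ z.2, z.1⟩) (fun z _ => ⟨z.2, z.1 \ z.2⟩) ?_ ?_ ?_ ?_ ?_
  · rintro ⟨A', S⟩ hz
    simp only [mem_sigma, mem_powersetCard, subset_sdiff] at hz ⊢
    obtain ⟨⟨h1, h2⟩, ⟨h3, h4⟩, h5⟩ := hz
    refine ⟨⟨union_subset h1 h3, ?_⟩, subset_union_left, h2⟩
    rw [card_union_of_disjoint h4.symm, h2, h5]
  · rintro ⟨D, A'⟩ hz
    simp only [mem_sigma, mem_powersetCard] at hz ⊢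
    obtain ⟨⟨h1, h2⟩, h3, h4⟩ := hz
    refine ⟨⟨h3.trans h1, h4⟩, sdiff_subset_sdiff h1 subset_rfl, ?_⟩
    rw [card_sdiff_of_subset h3, h2, h4]; omega
  · rintro ⟨A', S⟩ hz
    simp only [mem_sigma, mem_powersetCard, subset_sdiff] at hz ⊢
    obtain ⟨⟨h1, h2⟩, ⟨h3, h4⟩, h5⟩ := hz
    simp only [Sigma.mk.injEq, heq_eq_eq, true_and]
    rw [union_sdiff_left, h4.sdiff_eq_left]
  · rintro ⟨D, A'⟩ hz
    simp only [mem_sigma, mem_powersetCard] at hz ⊢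
    obtain ⟨⟨h1, h2⟩, h3, h4⟩ := hz
    simp only [Sigma.mk.injEq, heq_eq_eq, and_true]
    exact union_sdiff_of_subset h3
  · rintro ⟨A', S⟩ hz
    rfl

theorem prod_flip (S T : Finset K) :
    ∏ a ∈ S, ∏ b ∈ T, (a - b) = (-1) ^ (S.card * T.card) * ∏ b ∈ T, ∏ a ∈ S, (b - a) := by
  rw [prod_comm]
  have h2 : ∀ b ∈ T, ∏ a ∈ S, (a - b) = (-1) ^ S.card * ∏ a ∈ S, (b - a) := by
    intro b _
    rw [← prod_const, ← prod_mul_distrib]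
    exact prod_congr rfl fun a _ => by ring
  rw [prod_congr rfl h2, prod_mul_distrib, prod_const, ← pow_mul]

theorem prod_flip_one (x : K) (S : Finset K) :
    ∏ b ∈ S, (x - b) = (-1) ^ S.card * ∏ b ∈ S, (b - x) := by
  have := prod_flip {x} S
  simpa using this

theorem sub_prod_ne_zero (S T : Finset K) (h : Disjoint S T) :
    ∏ a ∈ S, ∏ b ∈ T, (a - b) ≠ 0 := by
  refine prod_ne_zero_iff.2 fun s hs => prod_ne_zero_iff.2 fun s' hs' => sub_ne_zero.2 ?_
  rintro rfl
  exact (disjoint_left.1 h hs) hs'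

theorem eval_Y (A' : Finset K) (x s : K) :
    ((X - C x) * ∏ a ∈ A', (X - C a)).eval s = (s - x) * ∏ a ∈ A', (s - a) := by
  simp [eval_prod]

theorem prod_eval_Y (A' S : Finset K) (x : K) :
    ∏ s ∈ S, ((X - C x) * ∏ a ∈ A', (X - C a)).eval s = (-1) ^ ((A'.card + 1) * S.card) *
      ((∏ s ∈ S, (x - s)) * ∏ a ∈ A', ∏ s ∈ S, (a - s)) := by
  simp only [eval_Y]
  rw [prod_mul_distrib, prod_flip_one x S, prod_flip A' S]
  have e : ((-1 : K) ^ S.card) * (-1) ^ S.card = 1 := by rw [← mul_pow]; simp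
  have e' : ((-1 : K) ^ (A'.card * S.card)) * (-1) ^ (A'.card * S.card) = 1 := by
    rw [← mul_pow]; simp
  rw [add_mul, pow_add, one_mul]
  linear_combination (-(∏ b ∈ S, (b - x)) * (∏ b ∈ S, ∏ a ∈ A', (b - a))) *
    ((-1 : K) ^ S.card * (-1) ^ S.card) * e' + (-(∏ b ∈ S, (b - x)) * (∏ b ∈ S, ∏ a ∈ A', (b - a))) * e

theorem neg_one_sq' (k : ℕ) : ((-1 : K) ^ k) * (-1) ^ k = 1 := by rw [← mul_pow]; simp

theorem inner_dsum [DecidableEq K] {p q m n : ℕ} (A' A1 B : Finset K) (hA' : A'.card = p)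
    (hA1 : A1.card = q + m) (hB : B.card = q + (p + n)) (hmn : 1 ≤ m + n) (x : K) :
    ∑ B' ∈ powersetCard q B, ((∏ a ∈ A', ∏ b ∈ B', (a - b)) * ∏ a ∈ A1, ∏ b ∈ B \ B', (a - b)) /
        (∏ b ∈ B', ∏ b' ∈ B \ B', (b - b')) * (∏ b ∈ B', (x - b)) =
      (-1) ^ ((p + 1) * q) * singleSum q A1
        (fun s => ((X - C x) * ∏ a ∈ A', (X - C a)).eval s)
        (fun s => (∏ b ∈ B, (X - C b)).eval s) := by
  have hY : ((X - C x) * ∏ a ∈ A', (X - C a)).natDegree ≤ m + (p + n) := by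
    refine natDegree_mul_le.trans ?_
    rw [natDegree_prod_of_monic _ _ fun a _ => monic_X_sub_C a]
    simp [hA']; omega
  have hex := exchange A1 B hA1 hB _ hY
  have hex' : singleSum q A1
        (fun s => ((X - C x) * ∏ a ∈ A', (X - C a)).eval s)
        (fun s => (∏ b ∈ B, (X - C b)).eval s) = (-1) ^ (m * (p + n)) *
        singleSum q B (fun s => ((X - C x) * ∏ a ∈ A', (X - C a)).eval s)
          (fun s => (∏ a ∈ A1, (X - C a)).eval s) := by
    rw [hex, ← mul_assoc, neg_one_sq', one_mul]
  rw [hex']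
  unfold singleSum
  rw [mul_sum, mul_sum]
  refine sum_congr rfl fun B' hB' => ?_
  obtain ⟨hs, hc⟩ := mem_powersetCard.1 hB'
  have hc2 : (B \ B').card = p + n := by rw [card_sdiff_of_subset hs, hB, hc]; omega
  rw [prod_eval_Y, hA', hc]
  rw [prod_flip A1 (B \ B'), prod_flip B' (B \ B'), hA1, hc, hc2]
  have e1 : ∀ s, (∏ a ∈ A1, (X - C a)).eval s = ∏ a ∈ A1, (s - a) := by
    intro s; simp [eval_prod]
  simp only [e1]
  have hne := sub_prod_ne_zero (B \ B') B' sdiff_disjoint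
  have hp1 := pow_ne_zero (q * (p + n)) (show (-1 : K) ≠ 0 by simp)
  field_simp
  rw [add_mul q m, pow_add]
  have s1 := neg_one_sq' (K := K) ((p + 1) * q)
  have s2 := neg_one_sq' (K := K) (q * (p + n))
  generalize (∏ b ∈ B \ B', ∏ a ∈ A1, (b - a)) = Z1
  generalize (∏ b ∈ B', (x - b)) = Z2
  generalize (∏ a ∈ A', ∏ b ∈ B', (a - b)) = Z3
  have s3 : ((-1 : K) ^ ((p + 1) * q)) ^ 2 = 1 := by rw [sq, s1]
  rw [s3]; ring

theorem double_sum [DecidableEq K] {p q m n : ℕ} (A B : Finset K)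
    (hA : A.card = p + q + m) (hB : B.card = p + q + n) (hmn : 1 ≤ m + n) (x : K) :
    ∑ A' ∈ powersetCard p A, ∑ B' ∈ powersetCard q B,
      ((∏ a ∈ A', ∏ b ∈ B', (a - b)) * ∏ a ∈ A \ A', ∏ b ∈ B \ B', (a - b)) /
        ((∏ a ∈ A', ∏ a' ∈ A \ A', (a - a')) * ∏ b ∈ B', ∏ b' ∈ B \ B', (b - b')) *
        ((∏ a ∈ A', (x - a)) * ∏ b ∈ B', (x - b)) =
      (-1) ^ (p * m) * ((p + q).choose p : K) * ((-1) ^ (p + q) *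
        singleSum (p + q) A (fun s => s - x) (fun s => (∏ b ∈ B, (X - C b)).eval s)) := by
  have hT := sum_union_pairs A p q (fun D => (-1) ^ (p + q) * ((∏ s ∈ D, (s - x)) *
    (∏ s ∈ A \ D, (∏ b ∈ B, (X - C b)).eval s) / ∏ s ∈ A \ D, ∏ s' ∈ D, (s - s')))
  rw [← mul_sum] at hT
  unfold singleSum
  rw [mul_assoc, ← hT, mul_sum]
  refine sum_congr rfl fun A' hA' => ?_
  obtain ⟨hs, hc⟩ := mem_powersetCard.1 hA'
  have hc1 : (A \ A').card = q + m := by rw [card_sdiff_of_subset hs, hA, hc]; omega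
  have hin := inner_dsum (n := n) A' (A \ A') B hc hc1 (by omega) hmn x
  have step : ∑ B' ∈ powersetCard q B,
      ((∏ a ∈ A', ∏ b ∈ B', (a - b)) * ∏ a ∈ A \ A', ∏ b ∈ B \ B', (a - b)) /
        ((∏ a ∈ A', ∏ a' ∈ A \ A', (a - a')) * ∏ b ∈ B', ∏ b' ∈ B \ B', (b - b')) *
        ((∏ a ∈ A', (x - a)) * ∏ b ∈ B', (x - b)) =
      (∏ a ∈ A', (x - a)) / (∏ a ∈ A', ∏ a' ∈ A \ A', (a - a')) *
      ∑ B' ∈ powersetCard q B, ((∏ a ∈ A', ∏ b ∈ B', (a - b)) * ∏ a ∈ A \ A', ∏ b ∈ B \ B', (a - b)) /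
        (∏ b ∈ B', ∏ b' ∈ B \ B', (b - b')) * (∏ b ∈ B', (x - b)) := by
    rw [mul_sum]
    refine sum_congr rfl fun B' _ => ?_
    rw [← div_div, div_right_comm]
    ring
  rw [step, hin]
  unfold singleSum
  rw [mul_sum, mul_sum, mul_sum]
  refine sum_congr rfl fun S hS => ?_
  obtain ⟨hs2, hc2⟩ := mem_powersetCard.1 hS
  have hdis : Disjoint A' S := (subset_sdiff.1 hs2).2.symm
  have hc3 : ((A \ A') \ S).card = m := by rw [card_sdiff_of_subset hs2, hc1, hc2]; omega
  rw [prod_eval_Y, hc, hc2]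
  have hsplit : A \ A' = S ∪ ((A \ A') \ S) := (union_sdiff_of_subset hs2).symm
  have hrest : A \ (A' ∪ S) = (A \ A') \ S := by
    ext y; simp only [mem_sdiff, mem_union]; tauto
  have hR : ∏ a ∈ A', ∏ a' ∈ A \ A', (a - a') =
      (∏ a ∈ A', ∏ a' ∈ S, (a - a')) * ∏ a ∈ A', ∏ a' ∈ (A \ A') \ S, (a - a') := by
    rw [← prod_mul_distrib]
    refine prod_congr rfl fun a _ => ?_
    conv_lhs => rw [hsplit]
    rw [prod_union disjoint_sdiff]
  have hR2 : ∏ s ∈ (A \ A') \ S, ∏ s' ∈ A' ∪ S, (s - s') =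
      (∏ s ∈ (A \ A') \ S, ∏ s' ∈ A', (s - s')) * ∏ s ∈ (A \ A') \ S, ∏ s' ∈ S, (s - s') := by
    rw [← prod_mul_distrib]
    exact prod_congr rfl fun a _ => prod_union hdis
  have hX : (-1) ^ (p + q) * ∏ s ∈ A' ∪ S, (s - x) = (∏ a ∈ A', (x - a)) * ∏ a ∈ S, (x - a) := by
    have : p + q = (A' ∪ S).card := by rw [card_union_of_disjoint hdis, hc, hc2]
    rw [this, ← prod_flip_one, prod_union hdis]
  have hd1 : Disjoint ((A \ A') \ S) A' := disjoint_of_subset_left sdiff_subset sdiff_disjoint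
  have n1 := sub_prod_ne_zero A' S hdis
  have n2 := sub_prod_ne_zero ((A \ A') \ S) S sdiff_disjoint
  have n3 := sub_prod_ne_zero ((A \ A') \ S) A' hd1
  rw [hrest, hR, hR2, prod_flip A' ((A \ A') \ S), hc, hc3,
    ← mul_div_assoc ((-1 : K) ^ (p + q)), ← mul_assoc ((-1 : K) ^ (p + q)), hX]
  have hp1 := pow_ne_zero (p * m) (show (-1 : K) ≠ 0 by simp)
  have s1 := neg_one_sq' (K := K) ((p + 1) * q)
  have s2 := neg_one_sq' (K := K) (p * m)
  generalize (∏ a ∈ A', (x - a)) = Z1 at *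
  generalize (∏ a ∈ S, (x - a)) = Z2 at *
  generalize (∏ a ∈ A', ∏ a' ∈ S, (a - a')) = Z3 at *
  generalize (∏ s ∈ (A \ A') \ S, ∏ s' ∈ A', (s - s')) = Z4 at *
  generalize (∏ s ∈ (A \ A') \ S, ∏ s' ∈ S, (s - s')) = Z5 at *
  generalize (∏ s ∈ (A \ A') \ S, (∏ b ∈ B, (X - C b)).eval s) = Z6 at *
  generalize ((-1 : K) ^ ((p + 1) * q)) = w1 at *
  generalize ((-1 : K) ^ (p * m)) = w2 at *
  field_simp
  linear_combination Z1 * Z2 * Z6 * s1 - Z1 * Z2 * Z6 * s2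

theorem eval_Sres_aux {t m n : ℕ} (hmn : 1 ≤ m + n) (f g : K[X]) (x : K) :
    (Sres f g (t + m) (t + n) t).eval x =
      (Matrix.of fun i j : Fin m ⊕ Fin n =>
        if (finSumFinEquiv j : ℕ) = 0 then
          ((Sum.elim (fun k : Fin m => g * X ^ (k : ℕ)) (fun l : Fin n => f * X ^ (l : ℕ)) i : K[X])).eval x
        else ((Sum.elim (fun k : Fin m => g * X ^ (k : ℕ))
          (fun l : Fin n => f * X ^ (l : ℕ)) i : K[X])).coeff (t + (finSumFinEquiv j : ℕ))).det := by
  unfold Sres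
  rw [← coe_evalRingHom, RingHom.map_det]
  have hN : m + n = t + m + (t + n) - 2 * t := by omega
  let ε : Fin m ⊕ Fin n ≃ Fin (t + m + (t + n) - 2 * t) :=
    finSumFinEquiv.trans (Fin.revPerm.trans (finCongr hN))
  rw [← Matrix.det_submatrix_equiv_self ε]
  congr 1
  have hε : ∀ j, (ε j : ℕ) = m + n - 1 - (finSumFinEquiv j : ℕ) := by
    intro j
    have := (finSumFinEquiv j).2
    simp only [ε, Equiv.trans_apply, Fin.revPerm_apply, finCongr_apply, Fin.val_cast, Fin.val_rev]
    omega
  ext i j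
  simp only [Matrix.submatrix_apply, RingHom.mapMatrix_apply, Matrix.map_apply, Matrix.of_apply]
  have hj : (finSumFinEquiv j : ℕ) < m + n := (finSumFinEquiv j).2
  have hcj := hε j
  have hr := hε i
  generalize (ε i : ℕ) = r at *
  generalize (ε j : ℕ) = c' at *
  generalize (finSumFinEquiv j : ℕ) = c at *
  rcases i with k | l
  · have hk := k.2
    simp only [finSumFinEquiv_apply_left, Fin.val_castAdd] at hr
    simp only [Sum.elim_inl]
    have hi : ¬ r < t + n - t := by omega
    have e1 : t + m - t - 1 - (r - (t + n - t)) = (k : ℕ) := by omega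
    by_cases hc : c = 0
    · have hc2 : c' = t + m + (t + n) - 2 * t - 1 := by omega
      simp only [hi, hc2, hc, e1, if_true, if_false, mul_comm (X ^ (k : ℕ))]
    · have hc2 : ¬ c' = t + m + (t + n) - 2 * t - 1 := by omega
      simp only [hi, hc2, hc, if_true, if_false, coeff_mul_X_pow']
      by_cases h : (k : ℕ) ≤ t + c
      · have h2 : c' ≤ t + n + (r - (t + n - t)) := by omega
        have h3 : t + n + (r - (t + n - t)) - c' = t + c - k := by omega
        simp only [h, h2, if_true, h3, coe_evalRingHom, eval_C]
      · have h2 : ¬ c' ≤ t + n + (r - (t + n - t)) := by omega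
        simp only [h, h2, if_false, map_zero]
  · have hl := l.2
    simp only [finSumFinEquiv_apply_right, Fin.val_natAdd] at hr
    simp only [Sum.elim_inr]
    have hi : r < t + n - t := by omega
    have e1 : t + n - t - 1 - r = (l : ℕ) := by omega
    by_cases hc : c = 0
    · have hc2 : c' = t + m + (t + n) - 2 * t - 1 := by omega
      simp only [hi, hc2, hc, e1, if_true, if_false, mul_comm (X ^ (l : ℕ))]
    · have hc2 : ¬ c' = t + m + (t + n) - 2 * t - 1 := by omega
      simp only [hi, hc2, hc, if_true, if_false, coeff_mul_X_pow']
      by_cases h : (l : ℕ) ≤ t + c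
      · have h2 : c' ≤ t + m + r := by omega
        have h3 : t + m + r - c' = t + c - l := by omega
        simp only [h, h2, if_true, h3, coe_evalRingHom, eval_C]
      · have h2 : ¬ c' ≤ t + m + r := by omega
        simp only [h, h2, if_false, map_zero]

theorem eval_Sres {t m n : ℕ} (hmn : 1 ≤ m + n) (f g : K[X]) (x : K)
    (hf : f.natDegree ≤ t + m) (hg : g.natDegree ≤ t + n) :
    (Sres f g (t + m) (t + n) t).eval x =
      (-1) ^ t * (blockMat t m n (X - C x) g f).det := by
  rw [eval_Sres_aux hmn]
  set D' := (Matrix.of fun i j : Fin m ⊕ Fin n =>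
        if (finSumFinEquiv j : ℕ) = 0 then
          ((Sum.elim (fun k : Fin m => g * X ^ (k : ℕ)) (fun l : Fin n => f * X ^ (l : ℕ)) i : K[X])).eval x
        else ((Sum.elim (fun k : Fin m => g * X ^ (k : ℕ))
          (fun l : Fin n => f * X ^ (l : ℕ)) i : K[X])).coeff (t + (finSumFinEquiv j : ℕ))) with hD'
  have : NeZero (t + m + n) := ⟨by omega⟩
  let ε : (Fin t ⊕ Fin m) ⊕ Fin n ≃ Fin (t + m + n) :=
    (Equiv.sumCongr finSumFinEquiv (Equiv.refl _)).trans finSumFinEquiv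
  have hε : ∀ j, colPos t m n j = (ε j : ℕ) := by
    intro j
    rcases j with j | j <;> simp [colPos, ε]
  let P := rowPoly t m n (X - C x) g f
  have hdeg : ∀ i, (P i).natDegree < t + m + n := by
    intro i
    rcases i with (i | i) | i <;> simp only [P, rowPoly, Sum.elim_inl, Sum.elim_inr] <;>
      refine lt_of_le_of_lt natDegree_mul_le ?_ <;>
      simp only [natDegree_X_pow, natDegree_X_sub_C] <;> have := i.2 <;> omega
  let C1 := (blockMat t m n (X - C x) g f).submatrix ε.symm ε.symm
  have hC1 : ∀ i j, C1 i j = (P (ε.symm i)).coeff j := by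
    intro i j
    simp [C1, blockMat, hε, P]
  have hC1d : C1.det = (blockMat t m n (X - C x) g f).det := Matrix.det_submatrix_equiv_self _ _
  let W : Matrix (Fin (t + m + n)) (Fin (t + m + n)) K :=
    Matrix.of fun i j => if j = 0 then x ^ (i : ℕ) else if i = j then 1 else 0
  have hW : W.det = 1 := by
    rw [Matrix.det_of_isLowerTriangular]
    · refine prod_eq_one fun k _ => ?_
      by_cases hk : k = 0
      · simp [W, hk]
      · simp [W, hk]
    · intro k l hkl
      have hkl' : k < l := hkl
      have h0 : l ≠ 0 := by rintro rfl; exact absurd hkl' (by simp)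
      change (if l = 0 then x ^ (k : ℕ) else if k = l then 1 else 0) = 0
      rw [if_neg h0, if_neg hkl'.ne]
  have hCW : ∀ i j, (C1 * W) i j = if j = 0 then (P (ε.symm i)).eval x
      else (P (ε.symm i)).coeff j := by
    intro i j
    rw [Matrix.mul_apply]
    split_ifs with hj
    · rw [eval_eq_sum_range' (hdeg _), Finset.sum_range]
      refine sum_congr rfl fun k _ => ?_
      simp [W, hj, hC1]
    · simp [W, hj, hC1]
  have ht : t < t + m + n := by omega
  have hperm := Matrix.det_permute' (Fin.cycleRange ⟨t, ht⟩) (C1 * W)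
  rw [Matrix.det_mul, hW, mul_one, hC1d, Fin.sign_cycleRange] at hperm
  let δ : Fin t ⊕ (Fin m ⊕ Fin n) ≃ Fin (t + m + n) := (Equiv.sumAssoc _ _ _).symm.trans ε
  rw [← Matrix.det_submatrix_equiv_self δ] at hperm
  have hδr : ∀ j : Fin m ⊕ Fin n, (δ (Sum.inr j) : ℕ) = t + (finSumFinEquiv j : ℕ) := by
    intro j; rcases j with j | j <;> simp [δ, ε, add_assoc]
  have hδl : ∀ j : Fin t, (δ (Sum.inl j) : ℕ) = j := by
    intro j; simp [δ, ε]
  let U : Matrix (Fin t) (Fin t) K := Matrix.of fun j c => ((X - C x) * X ^ (j : ℕ)).coeff ((c : ℕ) + 1)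
  have hU : U.det = 1 := by
    rw [Matrix.det_of_isLowerTriangular]
    · refine prod_eq_one fun k _ => ?_
      change ((X - C x) * X ^ (k : ℕ)).coeff ((k : ℕ) + 1) = 1
      rw [add_comm, coeff_mul_X_pow]
      simp [coeff_X, coeff_C]
    · intro k l hkl
      have hkl' : (k : ℕ) < l := hkl
      change ((X - C x) * X ^ (k : ℕ)).coeff ((l : ℕ) + 1) = 0
      apply coeff_eq_zero_of_natDegree_lt
      refine lt_of_le_of_lt natDegree_mul_le ?_
      rw [natDegree_X_pow, natDegree_X_sub_C]; omega
  have hrow : ∀ i, P (ε.symm (δ i)) = P ((Equiv.sumAssoc _ _ _).symm i) := by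
    intro i; simp [δ]
  have hcl : ∀ c : Fin t, ((Fin.cycleRange ⟨t, ht⟩ (δ (Sum.inl c)) : Fin (t + m + n)) : ℕ) = c + 1 := by
    intro c
    rw [Fin.coe_cycleRange_of_lt, hδl]
    rw [Fin.lt_def, hδl]; exact c.2
  have hcr0 : ∀ c : Fin m ⊕ Fin n, (finSumFinEquiv c : ℕ) = 0 →
      Fin.cycleRange ⟨t, ht⟩ (δ (Sum.inr c)) = 0 := by
    intro c hc
    apply Fin.cycleRange_of_eq
    apply Fin.ext
    rw [hδr, hc]; rfl
  have hcr : ∀ c : Fin m ⊕ Fin n, (finSumFinEquiv c : ℕ) ≠ 0 →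
      ((Fin.cycleRange ⟨t, ht⟩ (δ (Sum.inr c)) : Fin (t + m + n)) : ℕ) = t + (finSumFinEquiv c : ℕ) := by
    intro c hc
    rw [Fin.cycleRange_of_gt, hδr]
    rw [Fin.lt_def, hδr]
    change t < _
    omega
  have hblk : ∃ Z, ((C1 * W).submatrix id (Fin.cycleRange ⟨t, ht⟩)).submatrix δ δ =
      Matrix.fromBlocks U 0 Z D' := by
    refine ⟨Matrix.of fun i c => (P ((Equiv.sumAssoc _ _ _).symm (Sum.inr i))).coeff ((c : ℕ) + 1), ?_⟩
    ext i j
    rw [Matrix.submatrix_apply, Matrix.submatrix_apply, hCW]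
    simp only [id, hrow]
    rcases j with c | c
    · rw [if_neg, hcl]
      · rcases i with i | i
        · simp [P, rowPoly, U]
        · simp
      · intro h
        have := congrArg (fun z : Fin (t + m + n) => (z : ℕ)) h
        simp only [hcl] at this
        simp at this
    · by_cases hc : (finSumFinEquiv c : ℕ) = 0
      · rw [if_pos (hcr0 c hc)]
        rcases i with i | i
        · simp [P, rowPoly]
        · simp only [Matrix.fromBlocks_apply₂₂, hD', Matrix.of_apply, hc, if_true]
          rcases i with i | i <;> simp [P, rowPoly]
      · rw [if_neg, hcr c hc]
        · rcases i with i | i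
          · simp only [Matrix.fromBlocks_apply₁₂, Matrix.zero_apply]
            have hi := i.2
            apply coeff_eq_zero_of_natDegree_lt
            simp only [P, rowPoly, Equiv.sumAssoc_symm_apply_inl, Sum.elim_inl]
            refine lt_of_le_of_lt natDegree_mul_le ?_
            rw [natDegree_X_pow, natDegree_X_sub_C]; omega
          · simp only [Matrix.fromBlocks_apply₂₂, hD', Matrix.of_apply, hc, if_false]
            rcases i with i | i <;> simp [P, rowPoly]
        · intro h
          have := congrArg (fun z : Fin (t + m + n) => (z : ℕ)) h
          simp only [hcr c hc] at this
          simp at this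
          omega
  obtain ⟨Z, hZ⟩ := hblk
  rw [hZ, Matrix.det_fromBlocks_zero₁₂, hU, one_mul] at hperm
  rw [hperm]
  simp

end

theorem sylvester_double_sum {K : Type*} [Field K] [CharZero K] {d e : ℕ}
    (α : Fin d → K) (β : Fin e → K)
    (hα : Function.Injective α) (hβ : Function.Injective β)
    (p q t : ℕ) (hp : p ≤ d) (hq : q ≤ e) (ht : t = p + q)
    (hcase : (t < d ∧ d ≤ e) ∨ (t = d ∧ d < e)) :
    Sres (∏ i, (X - Polynomial.C (α i))) (∏ j, (X - Polynomial.C (β j))) d e t =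
      Polynomial.C ((-1 : K) ^ (p * (d - t)) * ((t.choose p : K))⁻¹) *
        ∑ A' ∈ Finset.powersetCard p (Finset.univ : Finset (Fin d)),
          ∑ B' ∈ Finset.powersetCard q (Finset.univ : Finset (Fin e)),
            Polynomial.C
                (((∏ i ∈ A', ∏ j ∈ B', (α i - β j)) *
                    ∏ i ∈ A'ᶜ, ∏ j ∈ B'ᶜ, (α i - β j)) /
                  ((∏ i ∈ A', ∏ i' ∈ A'ᶜ, (α i - α i')) *
                    ∏ j ∈ B', ∏ j' ∈ B'ᶜ, (β j - β j'))) *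
              ((∏ i ∈ A', (X - Polynomial.C (α i))) *
                ∏ j ∈ B', (X - Polynomial.C (β j))) := by
  classical
  obtain ⟨m, rfl⟩ : ∃ m, d = p + q + m := ⟨d - (p + q), by omega⟩
  obtain ⟨n, rfl⟩ : ∃ n, e = p + q + n := ⟨e - (p + q), by omega⟩
  subst ht
  have hmn : 1 ≤ m + n := by omega
  set A : Finset K := univ.map ⟨α, hα⟩ with hA
  set B : Finset K := univ.map ⟨β, hβ⟩ with hB
  have hAc : A.card = p + q + m := by simp [hA]
  have hBc : B.card = p + q + n := by simp [hB]
  have hfA : ∏ i, (X - Polynomial.C (α i)) = ∏ a ∈ A, (X - Polynomial.C a) := by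
    simp [hA, prod_map]
  have hgB : ∏ i, (X - Polynomial.C (β i)) = ∏ a ∈ B, (X - Polynomial.C a) := by
    simp [hB, prod_map]
  have hd : ∀ A : Finset K, (∏ a ∈ A, (X - Polynomial.C a)).natDegree = A.card := by
    intro A; rw [natDegree_prod_of_monic _ _ fun a _ => monic_X_sub_C a]; simp
  have hAs : ∀ S : Finset (Fin (p + q + m)), A \ S.map ⟨α, hα⟩ = Sᶜ.map ⟨α, hα⟩ := by
    intro S; rw [hA, compl_eq_univ_sdiff, Finset.map_sdiff]
  have hBs : ∀ S : Finset (Fin (p + q + n)), B \ S.map ⟨β, hβ⟩ = Sᶜ.map ⟨β, hβ⟩ := by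
    intro S; rw [hB, compl_eq_univ_sdiff, Finset.map_sdiff]
  apply Polynomial.funext
  intro x
  rw [hfA, hgB, eval_Sres hmn _ _ _ (by rw [hd, hAc]) (by rw [hd, hBc]),
    det_blockMat A hAc _ _ (by rw [natDegree_X_sub_C]; exact hmn) (by rw [hd, hBc])]
  have hmain := double_sum A B hAc hBc hmn x
  conv_lhs at hmain => rw [hA, powersetCard_map, sum_map]
  simp only [hB, powersetCard_map, sum_map] at hmain
  simp only [← hB, ← hA, RelEmbedding.coe_toEmbedding, mapEmbedding_apply, hAs, hBs, prod_map,
    Function.Embedding.coeFn_mk] at hmain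
  simp only [eval_mul, eval_C, eval_finset_sum, eval_prod, eval_sub, eval_X] at hmain ⊢
  rw [hmain]
  have hch : ((p + q).choose p : K) ≠ 0 := by
    exact_mod_cast (Nat.choose_pos (Nat.le_add_right p q)).ne'
  have s2 := neg_one_sq' (K := K) (p * m)
  rw [Nat.add_sub_cancel_left]
  field_simp
  rw [sq, s2, mul_one]
end

section
/- With the same setup, $\det V(\overline{A})\,\det V(\overline{B})\cdot\mathrm{Sres}_t(\overline{f},\overline{g})=(-1)^{(d-t)e}\det N$, where $N$ is the $(d+e)\times(d+e)$ matrix whose first $t$ rows are $[W_{x-z}(\overline{A})\mid 0]$ (Wronskian blocks of $h(z)=x-z$ of width $d$, then $e$ zero columns) and whose remaining $d+e-t$ rows are $[V_{d+e-t}(\overline{A})\mid V_{d+e-t}(\overline{B})]$. -/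
open Finset Polynomial

/-- Entry helper for the confluent Vandermonde matrix: `binom(k,j) * a^(k-j)`,
with the convention that it is `0` when `k < j`. -/
def dcoef {K : Type*} [CommRing K] (k j : ℕ) (a : K) : K :=
  if j ≤ k then (k.choose j : K) * a ^ (k - j) else 0

/-- The position in `Fin (∑ i, d i)` of the `j`-th column of the `i`-th block. -/
def sigmaToFin {m : ℕ} (d : Fin m → ℕ) (p : Σ i, Fin (d i)) : Fin (∑ i, d i) :=
  ⟨∑ i ∈ Finset.univ.filter (fun i => i < p.1), d i + (p.2 : ℕ), by
    have h1 : (p.2 : ℕ) < d p.1 := p.2.isLt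
    have h2 : d p.1 + ∑ i ∈ Finset.univ.filter (fun i => i < p.1), d i ≤ ∑ i, d i := by
      rw [← Finset.sum_insert (by simp)]
      exact Finset.sum_le_sum_of_subset (Finset.subset_univ _)
    omega⟩

/-- The square confluent (generalized Vandermonde) matrix of points `α i` with
multiplicities `d i`. -/
def confVdm {K : Type*} [CommRing K] {m : ℕ} (α : Fin m → K) (d : Fin m → ℕ) :
    Matrix (Fin (∑ i, d i)) (Fin (∑ i, d i)) K :=
  Matrix.of fun k c =>
    ∑ p : Σ i, Fin (d i),
      if (sigmaToFin d p : ℕ) = (c : ℕ) then dcoef (k : ℕ) (p.2 : ℕ) (α p.1) else 0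



open Matrix in
theorem swap_sign (m n : ℕ) :
    Equiv.Perm.sign (((Equiv.sumComm (Fin m) (Fin n)).trans
      (finSumFinEquiv.trans ((finCongr (Nat.add_comm n m)).trans finSumFinEquiv.symm)) :
        Equiv.Perm (Fin m ⊕ Fin n))) = (-1) ^ (m * n) := by
  rw [← Equiv.Perm.sign_symm_trans_trans _ (finSumFinEquiv : Fin m ⊕ Fin n ≃ Fin (m + n)),
    Equiv.Perm.sign_eq_prod_prod_Ioi]
  dsimp
  simp_rw [← finSumFinEquiv.prod_comp, ← Finset.prod_map_equiv finSumFinEquiv.symm]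
  simp only [Equiv.symm_apply_apply, Equiv.apply_symm_apply, Fin.cast_lt_cast, ← Fin.val_fin_lt, Equiv.symm_symm, Function.comp_apply,
    ← Finset.prod_ite_mem_eq (Finset.map _ _), Finset.mem_map_equiv, Finset.mem_Ioi,
    Fintype.prod_sum_type, finSumFinEquiv_apply_left, Fin.val_castAdd, Sum.swap_inl,
    finSumFinEquiv_apply_right, Fin.val_natAdd, Sum.swap_inr, add_lt_add_iff_left,
    ← ite_not (p := _ < _) (y := (1 : ℤˣ)), ← ite_and, and_not_self]
  have h1 : ∀ {k : ℕ} (x y : Fin k), ¬ (x < y ∧ y ≤ x) := fun x y h => absurd h.1 (not_lt.2 h.2)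
  simp [(Fin.isLt _).trans_le, (Fin.isLt _).le.trans, h1, ← pow_mul, Nat.mul_comm]

/-- annihilation of jets -/
theorem hasse_zero {K : Type*} [Field K] (a : K) (e j : ℕ) (hj : j < e) (p : K[X])
    (hp : (X - C a) ^ e ∣ p) (N : ℕ) (hN : p.natDegree < N) :
    ∑ k ∈ range N, p.coeff k * dcoef k j a = 0 := by
  have h0 : (hasseDeriv j p).eval a = 0 := by
    rw [← taylor_coeff]
    obtain ⟨q, rfl⟩ := hp
    rw [taylor_mul, taylor_pow]
    simp only [map_sub, taylor_X, taylor_C, add_sub_cancel_right]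
    rw [coeff_X_pow_mul', if_neg (by omega)]
  have h1 : hasseDeriv j p = ∑ k ∈ range N, hasseDeriv j (monomial k (p.coeff k)) := by
    rw [← _root_.map_sum (hasseDeriv j), ← p.as_sum_range' N hN]
  rw [h1, eval_finsetSum] at h0
  rw [← h0]
  refine Finset.sum_congr rfl fun k _ => ?_
  rw [hasseDeriv_monomial, eval_monomial, dcoef]
  split_ifs with h
  · ring
  · rw [Nat.choose_eq_zero_of_lt (by omega)]; simp

theorem conf_zero {K : Type*} [Field K] {m : ℕ} (α : Fin m → K) (dd : Fin m → ℕ) (c : ℕ) (p : K[X])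
    (hp : (∏ i, (X - Polynomial.C (α i)) ^ (dd i)) ∣ p) (N : ℕ) (hN : p.natDegree < N) :
    ∑ k ∈ range N, p.coeff k * (∑ q : Σ i, Fin (dd i),
      if (sigmaToFin dd q : ℕ) = c then dcoef k (q.2 : ℕ) (α q.1) else 0) = 0 := by
  simp_rw [Finset.mul_sum]
  rw [Finset.sum_comm]
  refine Finset.sum_eq_zero fun q _ => ?_
  by_cases h : (sigmaToFin dd q : ℕ) = c
  · simp only [h, if_true]
    have h2 : (X - Polynomial.C (α q.1)) ^ (dd q.1) ∣ ∏ i, (X - Polynomial.C (α i)) ^ (dd i) :=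
      Finset.dvd_prod_of_mem (fun i => (X - Polynomial.C (α i)) ^ (dd i)) (Finset.mem_univ q.1)
    exact hasse_zero (α q.1) (dd q.1) q.2 q.2.isLt p (h2.trans hp) N hN
  · simp [h]

/-- exponent attached to an index -/
def pos3 (t a b : ℕ) : Fin t ⊕ (Fin a ⊕ Fin b) → ℕ :=
  Sum.elim (fun r => (r : ℕ)) (Sum.elim (fun i => t + (i : ℕ)) (fun i => t + a + (i : ℕ)))

/-- exponent attached to an index -/
def pos2 (t a : ℕ) : Fin t ⊕ Fin a → ℕ :=
  Sum.elim (fun r => (r : ℕ)) (fun i => t + (i : ℕ))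

/-- coefficient rows of the extended Sylvester matrix -/
noncomputable def rowS {K : Type*} [Field K] (f g : K[X]) (t a b : ℕ) :
    Fin t ⊕ (Fin a ⊕ Fin b) → ℕ → K[X] :=
  Sum.elim (fun r k => (if k = (r : ℕ) then X else 0) - (if k = (r : ℕ) + 1 then 1 else 0))
    (Sum.elim (fun i k => C ((X ^ (i : ℕ) * g).coeff k)) (fun i k => C ((X ^ (i : ℕ) * f).coeff k)))

theorem sum_pos3 {R : Type*} [AddCommMonoid R] (t a b : ℕ) (φ : ℕ → R) :
    ∑ k, φ (pos3 t a b k) = ∑ k ∈ range (t + a + b), φ k := by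
  simp only [Fintype.sum_sum_type, pos3, Sum.elim_inl, Sum.elim_inr]
  rw [Finset.sum_range_add, Finset.sum_range_add, add_assoc,
    Fin.sum_univ_eq_sum_range (fun k => φ k), Fin.sum_univ_eq_sum_range (fun k => φ (t + k)),
    Fin.sum_univ_eq_sum_range (fun k => φ (t + a + k))]

theorem pos3_inj (t a b : ℕ) : Function.Injective (pos3 t a b) := by
  rintro (x | x | x) (y | y | y) h <;> simp [pos3] at h <;> 
    first | (have := x.isLt; have := y.isLt; omega) | (congr; omega) | (congr; exact Fin.ext h)

theorem rowS_eval {K : Type*} [Field K] (f g : K[X]) (t a b : ℕ) (hab : 1 ≤ a + b)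
    (hf : f.natDegree ≤ t + a) (hg : g.natDegree ≤ t + b) (r : Fin t ⊕ (Fin a ⊕ Fin b)) :
    ∑ k ∈ range (t + a + b), rowS f g t a b r k * X ^ k =
      Sum.elim (fun _ => 0) (Sum.elim (fun i : Fin a => X ^ (i : ℕ) * g) (fun i : Fin b => X ^ (i : ℕ) * f)) r := by
  rcases r with r | i | i
  · have := r.isLt
    simp only [rowS, Sum.elim_inl, sub_mul, Finset.sum_sub_distrib, ite_mul, zero_mul, one_mul,
      Finset.sum_ite_eq', Finset.mem_range]
    rw [if_pos (by omega), if_pos (by omega), pow_succ]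
    ring
  · have := i.isLt
    simp only [rowS, Sum.elim_inl, Sum.elim_inr]
    refine (as_sum_range_C_mul_X_pow' (X ^ (i : ℕ) * g) ?_).symm
    refine lt_of_le_of_lt natDegree_mul_le ?_
    simp only [natDegree_X_pow]; omega
  · have := i.isLt
    simp only [rowS, Sum.elim_inl, Sum.elim_inr]
    refine (as_sum_range_C_mul_X_pow' (X ^ (i : ℕ) * f) ?_).symm
    refine lt_of_le_of_lt natDegree_mul_le ?_
    simp only [natDegree_X_pow]; omega

/-- The reduced matrix. -/
noncomputable def redM {K : Type*} [Field K] (f g : K[X]) (t a b : ℕ) :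
    Matrix (Fin a ⊕ Fin b) (Fin a ⊕ Fin b) K[X] :=
  Matrix.of fun r c => if pos2 a b c = 0 then
      Sum.elim (fun i : Fin a => X ^ (i : ℕ) * g) (fun i : Fin b => X ^ (i : ℕ) * f) r
    else Sum.elim (fun i => C ((X ^ (i : ℕ) * g).coeff (t + pos2 a b c)))
      (fun i => C ((X ^ (i : ℕ) * f).coeff (t + pos2 a b c))) r

theorem sres_red {K : Type*} [Field K] (f g : K[X]) (t a b : ℕ) :
    Sres f g (t + a) (t + b) t = (redM f g t a b).det := by
  have hs : t + a + (t + b) - 2 * t = a + b := by omega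
  let E : Fin (t + a + (t + b) - 2 * t) ≃ Fin a ⊕ Fin b :=
    (finCongr hs).trans (Fin.revPerm.trans finSumFinEquiv.symm)
  rw [← Matrix.det_submatrix_equiv_self E, Sres]
  have hE : ∀ c : Fin (t + a + (t + b) - 2 * t), (c : ℕ) + pos2 a b (E c) + 1 = a + b := by
    intro c
    obtain ⟨x, rfl⟩ := E.symm.surjective c
    rw [Equiv.apply_symm_apply]
    rcases x with x | x <;> have := x.isLt <;> simp [E, pos2, Fin.val_rev] <;> omega
  congr 1
  ext1 r c
  have hc := hE c
  have hr := hE r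
  have hc1 := c.isLt
  have hr1 := r.isLt
  simp only [Matrix.of_apply, Matrix.submatrix_apply, redM]
  generalize hx : E r = x at *
  generalize pos2 a b (E c) = y at *
  rcases x with x | x
  · have := x.isLt
    simp only [pos2, Sum.elim_inl, Sum.elim_inr] at *
    rw [if_neg (by omega)]
    by_cases h : y = 0
    · rw [if_pos (by omega), if_pos h]
      congr 2; omega
    · rw [if_neg (by omega), if_neg h, coeff_X_pow_mul']
      by_cases h2 : (x : ℕ) ≤ t + y
      · rw [if_pos (by omega), if_pos h2]
        congr 2; omega
      · rw [if_neg (by omega), if_neg h2, C_0]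
  · have := x.isLt
    simp only [pos2, Sum.elim_inl, Sum.elim_inr] at *
    rw [if_pos (by omega)]
    by_cases h : y = 0
    · rw [if_pos (by omega), if_pos h]
      congr 2; omega
    · rw [if_neg (by omega), if_neg h, coeff_X_pow_mul']
      by_cases h2 : (x : ℕ) ≤ t + y
      · rw [if_pos (by omega), if_pos h2]
        congr 2; omega
      · rw [if_neg (by omega), if_neg h2, C_0]

/-- extended Sylvester matrix -/
noncomputable def extS {K : Type*} [Field K] (f g : K[X]) (t a b : ℕ) :
    Matrix (Fin t ⊕ (Fin a ⊕ Fin b)) (Fin t ⊕ (Fin a ⊕ Fin b)) K[X] :=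
  Matrix.of fun r c => rowS f g t a b r (pos3 t a b c)

theorem det_updateCol_mulVec' {R n : Type*} [CommRing R] [Fintype n] [DecidableEq n]
    (A : Matrix n n R) (x : n → R) (i : n) :
    (A.updateCol i (A.mulVec x)).det = A.det * x i := by
  rw [← Matrix.cramer_apply, Matrix.cramer_eq_adjugate_mulVec, Matrix.mulVec_mulVec,
    Matrix.adjugate_mul, Matrix.smul_mulVec, Matrix.one_mulVec]
  rfl

theorem sres_ext {K : Type*} [Field K] (f g : K[X]) (t a b : ℕ) (hab : 1 ≤ a + b)
    (hf : f.natDegree ≤ t + a) (hg : g.natDegree ≤ t + b) :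
    Sres f g (t + a) (t + b) t = (extS f g t a b).det := by
  rw [sres_red]
  obtain ⟨c0, hc0⟩ : ∃ c0 : Fin a ⊕ Fin b, pos2 a b c0 = 0 := by
    by_cases ha : a = 0
    · exact ⟨Sum.inr ⟨0, by omega⟩, by simp [pos2, ha]⟩
    · exact ⟨Sum.inl ⟨0, by omega⟩, by simp [pos2]⟩
  have hp : ∀ c, pos3 t a b (Sum.inr c) = t + pos2 a b c := by
    rintro (c | c) <;> simp [pos3, pos2, add_assoc]
  have hinj : ∀ c, pos2 a b c = 0 ↔ c = c0 := by
    intro c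
    constructor
    · intro h
      have : pos3 t a b (Sum.inr c) = pos3 t a b (Sum.inr c0) := by rw [hp, hp, h, hc0]
      exact Sum.inr_injective (pos3_inj _ _ _ this)
    · rintro rfl; exact hc0
  have key := det_updateCol_mulVec' (extS f g t a b) (fun k => X ^ pos3 t a b k) (Sum.inr c0)
  simp only [hp, hc0, add_zero] at key
  have hmv : (extS f g t a b).mulVec (fun k => X ^ pos3 t a b k) =
      Sum.elim (fun _ => 0) (Sum.elim (fun i : Fin a => X ^ (i : ℕ) * g) (fun i : Fin b => X ^ (i : ℕ) * f)) := by
    funext r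
    rw [← rowS_eval f g t a b hab hf hg r, ← sum_pos3 t a b (fun k => rowS f g t a b r k * X ^ k)]
    rfl
  let L : Matrix (Fin t) (Fin t) K[X] := Matrix.of fun r c =>
    (if (c : ℕ) = (r : ℕ) then X else 0) - (if (c : ℕ) = (r : ℕ) + 1 then 1 else 0)
  have hL : L.det = X ^ t := by
    rw [Matrix.det_of_isUpperTriangular]
    · simp [L]
    · intro r c h
      have h' : (c : ℕ) < r := h
      simp only [L, Matrix.of_apply]
      rw [if_neg (by omega), if_neg (by omega), sub_zero]
  have hblk : (extS f g t a b).updateCol (Sum.inr c0)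
      ((extS f g t a b).mulVec (fun k => X ^ pos3 t a b k)) =
      Matrix.fromBlocks L 0 (Matrix.of fun r c => extS f g t a b (Sum.inr r) (Sum.inl c))
        (redM f g t a b) := by
    rw [hmv]
    ext1 r c
    rcases c with c | c
    · rw [Matrix.updateCol_ne (by simp)]
      rcases r with r | r
      · rfl
      · rfl
    · by_cases hcc : c = c0
      · subst hcc
        rw [Matrix.updateCol_self]
        rcases r with r | r
        · rfl
        · simp [redM, hc0]
      · rw [Matrix.updateCol_ne (by simpa using hcc)]
        have h0 : pos2 a b c ≠ 0 := fun h => hcc ((hinj c).1 h)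
        rcases r with r | r | r
        · have := r.isLt
          simp only [extS, rowS, Matrix.of_apply, Sum.elim_inl, hp, Matrix.fromBlocks_apply₁₂,
            Matrix.zero_apply]
          rw [if_neg (by omega), if_neg (by omega), sub_zero]
        · simp [redM, h0, extS, rowS, hp]
        · simp [redM, h0, extS, rowS, hp]
  rw [hblk, Matrix.det_fromBlocks_zero₁₂, hL, mul_comm] at key
  exact mul_right_cancel₀ (pow_ne_zero t X_ne_zero) key

/-- The matrix `[W_A ; g V_A]`. -/
noncomputable def matD {K : Type*} [Field K] (f g : K[X]) (t a b : ℕ) (VA : ℕ → ℕ → K) :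
    Matrix (Fin t ⊕ Fin a) (Fin t ⊕ Fin a) K[X] :=
  Matrix.of fun r c => ∑ k ∈ range (t + a + b),
    rowS f g t a b (Equiv.sumAssoc _ _ _ (Sum.inl r)) k * C (VA k (pos2 t a c))

theorem pos3_assoc (t a b : ℕ) (c : (Fin t ⊕ Fin a) ⊕ Fin b) :
    pos3 t a b (Equiv.sumAssoc _ _ _ c) =
      Sum.elim (pos2 t a) (fun i : Fin b => t + a + (i : ℕ)) c := by
  rcases c with (c | c) | c <;> rfl

theorem monic_tri {K : Type*} [Field K] (f : K[X]) (d b : ℕ) (hf : f.Monic)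
    (hfd : f.natDegree = d) :
    (Matrix.of fun i j : Fin b => C ((X ^ (i : ℕ) * f).coeff (d + (j : ℕ)))).det = (1 : K[X]) := by
  rw [Matrix.det_of_isLowerTriangular]
  · refine Finset.prod_eq_one fun i _ => ?_
    simp only [Matrix.of_apply]
    rw [coeff_X_pow_mul, ← hfd, coeff_natDegree, hf.leadingCoeff, C_1]
  · intro i j h
    have h' : (i : ℕ) < j := h
    simp only [Matrix.of_apply]
    rw [coeff_X_pow_mul', if_pos (by omega), coeff_eq_zero_of_natDegree_lt (by omega), C_0]

theorem step2 {K : Type*} [Field K] (f g : K[X]) (t a b : ℕ) (VA : ℕ → ℕ → K)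
    (hf : f.Monic) (hfd : f.natDegree = t + a)
    (hA : ∀ p : K[X], f ∣ p → ∀ N, p.natDegree < N → ∀ c,
      ∑ k ∈ range N, p.coeff k * VA k c = 0) :
    (Matrix.of fun k c : Fin t ⊕ Fin a => C (VA (pos2 t a k) (pos2 t a c))).det *
      (extS f g t a b).det = (matD f g t a b VA).det := by
  rw [← Matrix.det_submatrix_equiv_self (Equiv.sumAssoc (Fin t) (Fin a) (Fin b))]
  let p : (Fin t ⊕ Fin a) ⊕ Fin b → ℕ := fun c => pos3 t a b (Equiv.sumAssoc _ _ _ c)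
  have hsum : ∀ φ : ℕ → K[X], ∑ k, φ (p k) = ∑ k ∈ range (t + a + b), φ k := by
    intro φ
    rw [← sum_pos3]
    exact (Equiv.sumAssoc (Fin t) (Fin a) (Fin b)).sum_comp (fun k => φ (pos3 t a b k))
  let U : Matrix ((Fin t ⊕ Fin a) ⊕ Fin b) ((Fin t ⊕ Fin a) ⊕ Fin b) K[X] :=
    Matrix.of fun k c => Sum.elim (fun c => C (VA (p k) (pos2 t a c)))
      (fun j : Fin b => if p k = t + a + (j : ℕ) then 1 else 0) c
  have hp2 : ∀ x, pos2 t a x < t + a := by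
    rintro (x | x) <;> have := x.isLt <;> simp only [pos2, Sum.elim_inl, Sum.elim_inr] <;> omega
  have hU : U = Matrix.fromBlocks
      (Matrix.of fun k c : Fin t ⊕ Fin a => C (VA (pos2 t a k) (pos2 t a c))) 0
      (Matrix.of fun (k : Fin b) c => C (VA (t + a + (k : ℕ)) (pos2 t a c))) 1 := by
    ext1 r c
    rcases r with r | r <;> rcases c with c | c
    · simp only [U, p, pos3_assoc]; rfl
    · have := hp2 r
      simp only [U, p, pos3_assoc, Matrix.of_apply, Sum.elim_inl, Sum.elim_inr,
        Matrix.fromBlocks_apply₁₂, Matrix.zero_apply]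
      exact if_neg (by omega)
    · simp only [U, p, pos3_assoc]; rfl
    · simp only [U, p, pos3_assoc, Matrix.of_apply, Sum.elim_inl, Sum.elim_inr,
        Matrix.fromBlocks_apply₂₂, Matrix.one_apply, add_right_inj, Fin.val_inj]
  have hUd : U.det =
      (Matrix.of fun k c : Fin t ⊕ Fin a => C (VA (pos2 t a k) (pos2 t a c))).det := by
    rw [hU, Matrix.det_fromBlocks_zero₁₂, Matrix.det_one, mul_one]
  rw [← hUd, mul_comm, ← Matrix.det_mul]
  have hprod : (extS f g t a b).submatrix (Equiv.sumAssoc (Fin t) (Fin a) (Fin b))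
      (Equiv.sumAssoc (Fin t) (Fin a) (Fin b)) * U =
      Matrix.fromBlocks (matD f g t a b VA)
        (Matrix.of fun r j => ((extS f g t a b).submatrix (Equiv.sumAssoc (Fin t) (Fin a) (Fin b))
      (Equiv.sumAssoc (Fin t) (Fin a) (Fin b)) * U) (Sum.inl r) (Sum.inr j)) 0
        (Matrix.of fun i j : Fin b => C ((X ^ (i : ℕ) * f).coeff (t + a + (j : ℕ)))) := by
    ext1 r c
    rcases r with r | r <;> rcases c with c | c
    · rw [Matrix.fromBlocks_apply₁₁, Matrix.mul_apply]
      exact hsum (fun k => rowS f g t a b (Equiv.sumAssoc _ _ _ (Sum.inl r)) k *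
        C (VA k (pos2 t a c)))
    · rfl
    · rw [Matrix.fromBlocks_apply₂₁, Matrix.mul_apply, Matrix.zero_apply]
      refine (hsum (fun k => C ((X ^ (r : ℕ) * f).coeff k) * C (VA k (pos2 t a c)))).trans ?_
      have h := hA (X ^ (r : ℕ) * f) (dvd_mul_left _ _) (t + a + b) (by
        refine lt_of_le_of_lt natDegree_mul_le ?_
        have := r.isLt
        simp only [natDegree_X_pow]; omega) (pos2 t a c)
      simp only [← C_mul]
      rw [← _root_.map_sum C, h, C_0]
    · rw [Matrix.fromBlocks_apply₂₂, Matrix.mul_apply]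
      refine (hsum (fun k => C ((X ^ (r : ℕ) * f).coeff k) *
        (if k = t + a + (c : ℕ) then 1 else 0))).trans ?_
      have := c.isLt
      simp
  rw [hprod, Matrix.det_fromBlocks_zero₂₁, monic_tri f (t + a) b hf hfd, mul_one]

/-- row-permuted version of the matrix `N` -/
noncomputable def matN {K : Type*} [Field K] (t a e : ℕ) (VA VB : ℕ → ℕ → K) :
    Matrix ((Fin t ⊕ Fin a) ⊕ Fin e) ((Fin t ⊕ Fin a) ⊕ Fin e) K[X] :=
  Matrix.fromBlocks
    (Matrix.of fun r c => Sum.elim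
      (fun r : Fin t => C (VA r (pos2 t a c)) * X - C (VA (r + 1) (pos2 t a c)))
      (fun i : Fin a => C (VA (e + i) (pos2 t a c))) r)
    (Matrix.of fun r c => Sum.elim (fun _ : Fin t => 0)
      (fun i : Fin a => C (VB (e + i) c)) r)
    (Matrix.of fun k c => C (VA k (pos2 t a c)))
    (Matrix.of fun k c => C (VB k c))

theorem step3 {K : Type*} [Field K] (f g : K[X]) (t a b : ℕ) (VA VB : ℕ → ℕ → K)
    (hab : 1 ≤ a + b) (hg : g.Monic) (hgd : g.natDegree = t + b)
    (hB : ∀ p : K[X], g ∣ p → ∀ N, p.natDegree < N → ∀ c,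
      ∑ k ∈ range N, p.coeff k * VB k c = 0) :
    (matN t a (t + b) VA VB).det = (matD f g t a b VA).det *
      (Matrix.of fun k c : Fin (t + b) => C (VB k c)).det := by
  let M : Matrix ((Fin t ⊕ Fin a) ⊕ Fin (t + b)) ((Fin t ⊕ Fin a) ⊕ Fin (t + b)) K[X] :=
    Matrix.fromBlocks
      (Matrix.fromBlocks 1 0 0
        (Matrix.of fun i j : Fin a => C ((X ^ (i : ℕ) * g).coeff (t + b + (j : ℕ)))))
      (Matrix.of fun r k => Sum.elim (fun _ : Fin t => 0)
        (fun i : Fin a => C ((X ^ (i : ℕ) * g).coeff k)) r) 0 1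
  have hM : M.det = 1 := by
    rw [Matrix.det_fromBlocks_zero₂₁, Matrix.det_fromBlocks_zero₂₁, monic_tri g (t + b) a hg hgd]
    simp
  have hsum : ∀ φ : ℕ → K[X], (∑ j : Fin a, φ (t + b + j)) + ∑ k : Fin (t + b), φ k =
      ∑ k ∈ range (t + a + b), φ k := by
    intro φ
    rw [show t + a + b = t + b + a by omega, Finset.sum_range_add, add_comm,
      Fin.sum_univ_eq_sum_range (fun k => φ (t + b + k)), Fin.sum_univ_eq_sum_range (fun k => φ k)]
  have hprod : M * matN t a (t + b) VA VB =
      Matrix.fromBlocks (matD f g t a b VA) 0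
        (Matrix.of fun (k : Fin (t + b)) c => C (VA k (pos2 t a c)))
        (Matrix.of fun k c : Fin (t + b) => C (VB k c)) := by
    rw [matN, Matrix.fromBlocks_multiply]
    congr 1
    · ext1 r c
      rcases r with r | r
      · have := r.isLt
        simp only [Matrix.add_apply, Matrix.mul_apply, Fintype.sum_sum_type, matD, Matrix.of_apply,
          Matrix.fromBlocks_apply₁₁, Matrix.fromBlocks_apply₁₂, Sum.elim_inl, Sum.elim_inr,
          Matrix.zero_apply, zero_mul, Finset.sum_const_zero, add_zero, Matrix.one_apply, ite_mul,
          one_mul, Finset.sum_ite_eq, Finset.mem_univ, if_true, rowS, Equiv.sumAssoc_apply_inl_inl,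
          sub_mul, Finset.sum_sub_distrib, Finset.sum_ite_eq', Finset.mem_range]
        rw [if_pos (by omega), if_pos (by omega), mul_comm]
      · simp only [Matrix.add_apply, Matrix.mul_apply, Fintype.sum_sum_type, matD, Matrix.of_apply,
          Matrix.fromBlocks_apply₂₁, Matrix.fromBlocks_apply₂₂, Sum.elim_inl, Sum.elim_inr,
          Matrix.zero_apply, zero_mul, Finset.sum_const_zero, zero_add,
          rowS, Equiv.sumAssoc_apply_inl_inr]
        generalize X ^ (r : ℕ) * g = q
        exact hsum (fun k => C (q.coeff k) * C (VA k (pos2 t a c)))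
    · ext1 r c
      rcases r with r | r
      · simp [Matrix.mul_apply, Matrix.one_apply]
      · simp only [Matrix.add_apply, Matrix.mul_apply, Fintype.sum_sum_type, Matrix.of_apply,
          Matrix.fromBlocks_apply₂₁, Matrix.fromBlocks_apply₂₂, Sum.elim_inl, Sum.elim_inr,
          Matrix.zero_apply, zero_mul, Finset.sum_const_zero, zero_add]
        have h := hB (X ^ (r : ℕ) * g) (dvd_mul_left _ _) (t + a + b) (by
          refine lt_of_le_of_lt natDegree_mul_le ?_
          have := r.isLt
          simp only [natDegree_X_pow]; omega) c
        generalize X ^ (r : ℕ) * g = q at h ⊢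
        rw [hsum (fun k => C (q.coeff k) * C (VB k c))]
        simp only [← C_mul]
        rw [← _root_.map_sum C, h, C_0]
    · simp
    · simp
  rw [← one_mul (matN t a (t + b) VA VB).det, ← hM, ← Matrix.det_mul, hprod,
    Matrix.det_fromBlocks_zero₁₂]

theorem step4 {K : Type*} [Field K] (t a e : ℕ) (VA VB : ℕ → ℕ → K) :
    (matN t a e VA VB).det = (-1) ^ (a * e) *
      Matrix.det (Matrix.of fun r c : Fin (t + a + e) =>
          if (r : ℕ) < t then
            if (c : ℕ) < t + a then C (VA r c) * X - C (VA ((r : ℕ) + 1) c) else 0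
          else
            if (c : ℕ) < t + a then C (VA ((r : ℕ) - t) c)
            else C (VB ((r : ℕ) - t) ((c : ℕ) - (t + a)))) := by
  let e2 : (Fin t ⊕ Fin a) ⊕ Fin e ≃ Fin (t + a + e) :=
    (Equiv.sumCongr finSumFinEquiv (Equiv.refl _)).trans finSumFinEquiv
  let ρ : Equiv.Perm (Fin a ⊕ Fin e) := (Equiv.sumComm (Fin a) (Fin e)).trans
      (finSumFinEquiv.trans ((finCongr (Nat.add_comm e a)).trans finSumFinEquiv.symm))
  let π : Equiv.Perm ((Fin t ⊕ Fin a) ⊕ Fin e) :=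
    (Equiv.sumAssoc (Fin t) (Fin a) (Fin e)).trans
      ((Equiv.Perm.sumCongr 1 ρ).trans (Equiv.sumAssoc (Fin t) (Fin a) (Fin e)).symm)
  have hπ : Equiv.Perm.sign π = (-1) ^ (a * e) := by
    rw [← swap_sign a e]
    have := Equiv.Perm.sign_trans_trans_symm (Equiv.Perm.sumCongr (1 : Equiv.Perm (Fin t)) ρ)
      (Equiv.sumAssoc (Fin t) (Fin a) (Fin e))
    rw [Equiv.Perm.sign_sumCongr, map_one, one_mul] at this
    exact this
  rw [← Matrix.det_submatrix_equiv_self e2]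
  have hcast : ((Equiv.Perm.sign π : ℤ) : K[X]) = (-1) ^ (a * e) := by
    rw [hπ]; push_cast; rfl
  rw [← hcast, ← Matrix.det_permute]
  have he2 : ∀ x : Fin t ⊕ (Fin a ⊕ Fin e),
      ((e2 ((Equiv.sumAssoc (Fin t) (Fin a) (Fin e)).symm x) : Fin _) : ℕ) = pos3 t a e x := by
    rintro (x | x | x) <;> simp [e2, pos3]
  have hρ : ∀ y, pos2 a e (ρ y) = Sum.elim (fun i : Fin a => e + (i : ℕ)) (fun k : Fin e => (k : ℕ)) y := by
    have h3 : ∀ z : Fin (a + e), pos2 a e (finSumFinEquiv.symm z) = z := by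
      intro z
      obtain ⟨w, rfl⟩ := finSumFinEquiv.surjective z
      rw [Equiv.symm_apply_apply]
      rcases w with w | w <;> simp [pos2]
    intro y
    simp only [ρ, Equiv.trans_apply, h3]
    rcases y with y | y <;> simp [add_comm]
  have hp : ∀ c, pos3 t a e (Sum.inr c) = t + pos2 a e c := by
    rintro (c | c) <;> simp [pos3, pos2, add_assoc]
  have hrow : ∀ x, ((e2 (π x) : Fin _) : ℕ) = Sum.elim (Sum.elim (fun r : Fin t => (r : ℕ))
      (fun i : Fin a => t + (e + (i : ℕ)))) (fun k : Fin e => t + (k : ℕ)) x := by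
    intro x
    simp only [π, Equiv.trans_apply, he2]
    rcases x with (x | x) | x
    · rfl
    · change pos3 t a e (Sum.inr (ρ (Sum.inl x))) = _
      rw [hp, hρ]; rfl
    · change pos3 t a e (Sum.inr (ρ (Sum.inr x))) = _
      rw [hp, hρ]; rfl
  have hcol : ∀ x, ((e2 x : Fin _) : ℕ) =
      Sum.elim (pos2 t a) (fun k : Fin e => t + a + (k : ℕ)) x := by
    rintro ((x | x) | x) <;> simp [e2, pos2]
  have hp2 : ∀ x, pos2 t a x < t + a := by
    rintro (x | x) <;> have := x.isLt <;> simp only [pos2, Sum.elim_inl, Sum.elim_inr] <;> omega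
  congr 1
  ext1 r c
  simp only [Matrix.submatrix_apply, Matrix.of_apply, hrow, hcol, id]
  rcases r with (r | r) | r <;> rcases c with c | c <;>
    simp [matN, hp2]

theorem abs_main {K : Type*} [Field K] (f g : K[X]) (VA VB : ℕ → ℕ → K) (d e t : ℕ)
    (hcase : (t ≤ d ∧ d < e) ∨ (t < d ∧ d = e))
    (hf : f.Monic) (hfd : f.natDegree = d) (hg : g.Monic) (hgd : g.natDegree = e)
    (hA : ∀ p : K[X], f ∣ p → ∀ N, p.natDegree < N → ∀ c,
      ∑ k ∈ range N, p.coeff k * VA k c = 0)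
    (hB : ∀ p : K[X], g ∣ p → ∀ N, p.natDegree < N → ∀ c,
      ∑ k ∈ range N, p.coeff k * VB k c = 0) :
    C ((Matrix.of fun k c : Fin d => VA k c).det * (Matrix.of fun k c : Fin e => VB k c).det) *
      Sres f g d e t = (-1) ^ ((d - t) * e) *
      Matrix.det (Matrix.of fun r c : Fin (d + e) =>
          if (r : ℕ) < t then
            if (c : ℕ) < d then C (VA r c) * X - C (VA ((r : ℕ) + 1) c) else 0
          else
            if (c : ℕ) < d then C (VA ((r : ℕ) - t) c)
            else C (VB ((r : ℕ) - t) ((c : ℕ) - d))) := by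
  obtain ⟨a, rfl⟩ : ∃ a, d = t + a := ⟨d - t, by omega⟩
  obtain ⟨b, rfl⟩ : ∃ b, e = t + b := ⟨e - t, by omega⟩
  have hab : 1 ≤ a + b := by omega
  rw [sres_ext f g t a b hab hfd.le hgd.le, Nat.add_sub_cancel_left, ← step4,
    step3 f g t a b VA VB hab hg hgd hB, ← step2 f g t a b VA hf hfd hA]
  have h1 : (Matrix.of fun k c : Fin t ⊕ Fin a => C (VA (pos2 t a k) (pos2 t a c))).det =
      C (Matrix.of fun k c : Fin (t + a) => VA k c).det := by
    rw [RingHom.map_det, ← Matrix.det_submatrix_equiv_self finSumFinEquiv]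
    congr 1
    have : ∀ x : Fin t ⊕ Fin a, ((finSumFinEquiv x : Fin _) : ℕ) = pos2 t a x := by
      rintro (x | x) <;> simp [pos2]
    ext1 r c
    simp [this]
  have h2 : (Matrix.of fun k c : Fin (t + b) => C (VB k c)).det =
      C (Matrix.of fun k c : Fin (t + b) => VB k c).det := by
    rw [RingHom.map_det]
    rfl
  rw [h1, h2, C_mul]
  ring

/-- `det V(Ā) det V(B̄) ⬝ Sres_t(f̄,ḡ) = (-1)^{(d-t)e} det N`, where `N` is the
`(d+e)×(d+e)` matrix whose first `t` rows are `[W_{x-z}(Ā) | 0]` (generalized Wronskian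
blocks of `h(z) = x - z`) and whose last `d+e-t` rows are `[V_{d+e-t}(Ā) | V_{d+e-t}(B̄)]`. -/
theorem sres_vdm_vdm {K : Type*} [Field K] [CharZero K] {m n : ℕ}
    (α : Fin m → K) (β : Fin n → K)
    (hα : Function.Injective α) (hβ : Function.Injective β)
    (dd : Fin m → ℕ) (ee : Fin n → ℕ) (hdd : ∀ i, 1 ≤ dd i) (hee : ∀ j, 1 ≤ ee j)
    (d e t : ℕ) (hd : d = ∑ i, dd i) (he : e = ∑ j, ee j)
    (hcase : (t ≤ d ∧ d < e) ∨ (t < d ∧ d = e)) :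
    Polynomial.C ((confVdm α dd).det * (confVdm β ee).det) *
        Sres (∏ i, (X - Polynomial.C (α i)) ^ (dd i))
          (∏ j, (X - Polynomial.C (β j)) ^ (ee j)) d e t =
      (-1 : Polynomial K) ^ ((d - t) * e) *
        Matrix.det (Matrix.of fun r c : Fin (d + e) =>
          if (r : ℕ) < t then
            -- row of `W_{x-z}(Ā)`: the `(r, (i,j))` entry is
            -- `(1/j!) (z^r (x - z))^{(j)}|_{z = αᵢ} = binom(r,j) αᵢ^{r-j} x - binom(r+1,j) αᵢ^{r+1-j}`
            if (c : ℕ) < d then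
              ∑ p : Σ i, Fin (dd i),
                if (sigmaToFin dd p : ℕ) = (c : ℕ) then
                  Polynomial.C (dcoef (r : ℕ) (p.2 : ℕ) (α p.1)) * X -
                    Polynomial.C (dcoef ((r : ℕ) + 1) (p.2 : ℕ) (α p.1))
                else 0
            else 0
          else
            if (c : ℕ) < d then
              ∑ p : Σ i, Fin (dd i),
                if (sigmaToFin dd p : ℕ) = (c : ℕ) then
                  Polynomial.C (dcoef ((r : ℕ) - t) (p.2 : ℕ) (α p.1))
                else 0
            else
              ∑ p : Σ j, Fin (ee j),
                if (sigmaToFin ee p : ℕ) = (c : ℕ) - d then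
                  Polynomial.C (dcoef ((r : ℕ) - t) (p.2 : ℕ) (β p.1))
                else 0) := by
  subst hd he
  have hmon : ∀ {k : ℕ} (γ : Fin k → K) (s : Fin k → ℕ),
      (∏ i, (X - Polynomial.C (γ i)) ^ (s i)).Monic ∧
      (∏ i, (X - Polynomial.C (γ i)) ^ (s i)).natDegree = ∑ i, s i := by
    intro k γ s
    have h : ∀ i ∈ (Finset.univ : Finset (Fin k)), ((X - Polynomial.C (γ i)) ^ (s i)).Monic :=
      fun i _ => (monic_X_sub_C _).pow _
    refine ⟨monic_prod_of_monic _ _ h, ?_⟩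
    rw [natDegree_prod_of_monic _ _ h]
    simp [natDegree_pow]
  let VA : ℕ → ℕ → K := fun k c => ∑ q : Σ i, Fin (dd i),
      if (sigmaToFin dd q : ℕ) = c then dcoef k (q.2 : ℕ) (α q.1) else 0
  let VB : ℕ → ℕ → K := fun k c => ∑ q : Σ i, Fin (ee i),
      if (sigmaToFin ee q : ℕ) = c then dcoef k (q.2 : ℕ) (β q.1) else 0
  have key := abs_main (∏ i, (X - Polynomial.C (α i)) ^ (dd i))
    (∏ j, (X - Polynomial.C (β j)) ^ (ee j)) VA VB (∑ i, dd i) (∑ j, ee j) t hcase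
    (hmon α dd).1 (hmon α dd).2 (hmon β ee).1 (hmon β ee).2
    (fun p hp N hN c => conf_zero α dd c p hp N hN)
    (fun p hp N hN c => conf_zero β ee c p hp N hN)
  refine Eq.trans key ?_
  congr 2
  ext1 r c
  have hC : ∀ k c : ℕ, Polynomial.C (VA k c) = ∑ q : Σ i, Fin (dd i),
      if (sigmaToFin dd q : ℕ) = c then Polynomial.C (dcoef k (q.2 : ℕ) (α q.1)) else 0 := by
    intro k c
    simp only [VA, _root_.map_sum, apply_ite Polynomial.C, C_0]
  have hC' : ∀ k c : ℕ, Polynomial.C (VB k c) = ∑ q : Σ i, Fin (ee i),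
      if (sigmaToFin ee q : ℕ) = c then Polynomial.C (dcoef k (q.2 : ℕ) (β q.1)) else 0 := by
    intro k c
    simp only [VB, _root_.map_sum, apply_ite Polynomial.C, C_0]
  simp only [Matrix.of_apply, hC, hC']
  rw [Finset.sum_mul, ← Finset.sum_sub_distrib]
  split_ifs
  · refine Finset.sum_congr rfl fun q _ => ?_
    split_ifs <;> simp
  · rfl
  · rfl
  · rfl
end
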